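/- arXiv:2605.22397 — 2 statements merged into one kernel-verified Lean document; each statement's English description precedes it below -/
import Mathlib

section
/- For all integers m ≥ 2 and t ≥ 1 there exists n_0 such that for all n ≥ n_0: ex_3(n, (t+1)·F_5^S(m)) = e(G(t,m,n)) = e(T_3(n−t,3)) + C(n,3) − C(n−t,3), and G(t,m,n) attains this maximum; that is, G(t,m,n) is a (t+1)·F_5^S(m)-free n-vertex 3-graph with the maximum number of hyperedges. -/
open Finset

/-- `H` (a 3-graph given by its edge set on vertex type `V`) contains a copy of the
3-graph `F` (given by its edge set on vertex type `W`). -/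
def HasCopy {V W : Type*} [DecidableEq V] [DecidableEq W]
    (H : Finset (Finset V)) (F : Finset (Finset W)) : Prop :=
  ∃ f : W ↪ V, ∀ e ∈ F, e.image f ∈ H

/-- The Turán number `ex_3(n, F)`: the maximum number of hyperedges of an `F`-free
3-uniform hypergraph on `n` vertices. -/
noncomputable def exThree {W : Type*} [DecidableEq W] (n : ℕ) (F : Finset (Finset W)) : ℕ :=
  sSup {k | ∃ H : Finset (Finset (Fin n)), (∀ e ∈ H, e.card = 3) ∧ ¬ HasCopy H F ∧ H.card = k}

/-- The `i`-th part of the balanced tripartition of `Fin n` (vertices with residue `i` mod 3);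
the parts have sizes `⌊n/3⌋` or `⌈n/3⌉`. -/
def turanPart (n : ℕ) (i : Fin 3) : Finset (Fin n) :=
  Finset.univ.filter (fun v => (v : ℕ) % 3 = (i : ℕ))

/-- The balanced complete tripartite 3-graph `T_3(n,3)`: hyperedges are exactly the triples
with one vertex in each part of the balanced tripartition. -/
def T3 (n : ℕ) : Finset (Finset (Fin n)) :=
  Finset.univ.filter (fun e => e.card = 3 ∧ ∀ i : Fin 3, (e ∩ turanPart n i).card = 1)

/-- The 3-graph `F_5` on `{f_1, …, f_5}` with hyperedges `f_1f_2f_3, f_1f_2f_4, f_3f_4f_5`. -/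
def F5 : Finset (Finset (Fin 5)) := {{0,1,2},{0,1,3},{2,3,4}}

/-- `F_5(f_5;t)`: `F_5` with the vertex `f_5` blown up to `t` copies.
Here `inl 0, inl 1, inl 2, inl 3` play the roles of `f_1,f_2,f_3,f_4` and the
vertices `inr j` are the `t` copies of `f_5`. -/
def F5b5 (t : ℕ) : Finset (Finset (Fin 4 ⊕ Fin t)) :=
  ({({Sum.inl 0, Sum.inl 1, Sum.inl 2} : Finset (Fin 4 ⊕ Fin t)),
    ({Sum.inl 0, Sum.inl 1, Sum.inl 3} : Finset (Fin 4 ⊕ Fin t))} :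
      Finset (Finset (Fin 4 ⊕ Fin t))) ∪
  Finset.univ.image (fun j : Fin t => ({Sum.inl 2, Sum.inl 3, Sum.inr j} : Finset (Fin 4 ⊕ Fin t)))

/-- `F_5(f_3;t)`: `F_5` with the vertex `f_3` blown up to `t` copies.
Here `inl 0, inl 1, inl 2, inl 3` play the roles of `f_1,f_2,f_4,f_5` and the
vertices `inr j` are the `t` copies of `f_3`. -/
def F5b3 (t : ℕ) : Finset (Finset (Fin 4 ⊕ Fin t)) :=
  ({({Sum.inl 0, Sum.inl 1, Sum.inl 2} : Finset (Fin 4 ⊕ Fin t))} :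
      Finset (Finset (Fin 4 ⊕ Fin t))) ∪
  Finset.univ.image (fun j : Fin t => ({Sum.inl 0, Sum.inl 1, Sum.inr j} : Finset (Fin 4 ⊕ Fin t))) ∪
  Finset.univ.image (fun j : Fin t => ({Sum.inr j, Sum.inl 2, Sum.inl 3} : Finset (Fin 4 ⊕ Fin t)))

/-- `S^t(N)` (the size of `D(N,3,t,2)`): the maximum number of hyperedges of a 3-graph on `N`
vertices in which every pair of vertices is contained in at most `t-1` hyperedges. -/
noncomputable def Dmax (N t : ℕ) : ℕ :=
  sSup {k | ∃ H : Finset (Finset (Fin N)), (∀ e ∈ H, e.card = 3) ∧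
    (∀ u v : Fin N, u ≠ v → (H.filter (fun e => u ∈ e ∧ v ∈ e)).card ≤ t - 1) ∧ H.card = k}

/-- `e(T_3(n,3)^{t+})`: the number of hyperedges of `T_3(n,3)` together with a maximum
3-graph inside each part in which every pair of vertices lies in at most `t-1` hyperedges. -/
noncomputable def eT3plus (n t : ℕ) : ℕ :=
  (T3 n).card + ∑ i : Fin 3, Dmax ((turanPart n i).card) t

/-- `F` is a subgraph of a blow-up of `F_5`: every edge is a triple, and there is a map
to `V(F_5)` that is injective on each edge and sends each edge to an edge of `F_5`. -/
def IsSubBlowupF5 {W : Type*} [DecidableEq W] (F : Finset (Finset W)) : Prop :=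
  (∀ e ∈ F, e.card = 3) ∧ ∃ φ : W → Fin 5, ∀ e ∈ F, (e.image φ).card = 3 ∧ e.image φ ∈ F5

/-- The complete tripartite 3-graph with parts `A`, `B`, `C`: all triples with exactly
one vertex in each of `A`, `B`, `C`. -/
def tripartiteEdges {n : ℕ} (A B C : Finset (Fin n)) : Finset (Finset (Fin n)) :=
  Finset.univ.filter (fun e =>
    (e ∩ A).card = 1 ∧ (e ∩ B).card = 1 ∧ (e ∩ C).card = 1 ∧ e.card = 3)

/-- The complete 3-partite 3-graph `K_{t,s,s}` with parts of sizes `t`, `s`, `s`. -/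
def Ktss (t s : ℕ) : Finset (Finset (Fin t ⊕ Fin s ⊕ Fin s)) :=
  Finset.univ.image (fun x : Fin t × Fin s × Fin s =>
    ({Sum.inl x.1, Sum.inr (Sum.inl x.2.1), Sum.inr (Sum.inr x.2.2)} :
      Finset (Fin t ⊕ Fin s ⊕ Fin s)))

/-- All hyperedges of `H` consist of one vertex of the `A`-side (`Fin mA`) and two
vertices of the `B`-side (`Fin nB`). -/
def BipShape (mA nB : ℕ) (H : Finset (Finset (Fin mA ⊕ Fin nB))) : Prop :=
  ∀ e ∈ H, ∃ a : Fin mA, ∃ b c : Fin nB, b ≠ c ∧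
    e = ({Sum.inl a, Sum.inr b, Sum.inr c} : Finset (Fin mA ⊕ Fin nB))

/-- `H` contains a copy of `K_{t,s,s}` whose `t`-vertex part lies on the `A`-side and whose
two `s`-vertex parts lie on the `B`-side. -/
def HasBipKtss (mA nB t s : ℕ) (H : Finset (Finset (Fin mA ⊕ Fin nB))) : Prop :=
  ∃ (T : Finset (Fin mA)) (S0 S1 : Finset (Fin nB)), T.card = t ∧
    S0.card = s ∧ S1.card = s ∧ Disjoint S0 S1 ∧
    ∀ a ∈ T, ∀ b ∈ S0, ∀ c ∈ S1,
      ({Sum.inl a, Sum.inr b, Sum.inr c} : Finset (Fin mA ⊕ Fin nB)) ∈ H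

/-- The bipartite Turán number `ex_3^{bip}(mA, nB, K_{t,s,s})`. -/
noncomputable def exBip (mA nB t s : ℕ) : ℕ :=
  sSup {k | ∃ H : Finset (Finset (Fin mA ⊕ Fin nB)),
    BipShape mA nB H ∧ ¬ HasBipKtss mA nB t s H ∧ H.card = k}

/-- The `s`-set `S_0` inside the residue-0 part of `T_3(3m,3)`. -/
def S0set (m s : ℕ) (h : 2*s ≤ m) : Finset (Fin (3*m)) :=
  Finset.univ.image (fun i : Fin s => (⟨3*i.val, by have := i.isLt; omega⟩ : Fin (3*m)))

/-- The `s`-set `S_1` inside the residue-0 part of `T_3(3m,3)`, disjoint from `S_0`. -/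
def S1set (m s : ℕ) (h : 2*s ≤ m) : Finset (Fin (3*m)) :=
  Finset.univ.image (fun i : Fin s => (⟨3*(s+i.val), by have := i.isLt; omega⟩ : Fin (3*m)))

/-- The 3-graph `F_5^S(m,t,K_{s,s})`: `T_3(3m,3)` (on the `inl` vertices) together with a set
`T` of `t` new vertices (the `inr` vertices) and all triples consisting of one vertex of `T`,
one vertex of `S_0` and one vertex of `S_1`. -/
def F5Stss (m t s : ℕ) (h : 2*s ≤ m) : Finset (Finset (Fin (3*m) ⊕ Fin t)) :=
  (T3 (3*m)).image (fun e => e.image Sum.inl) ∪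
  Finset.univ.biUnion (fun j : Fin t =>
    ((S0set m s h) ×ˢ (S1set m s h)).image (fun p =>
      ({Sum.inr j, Sum.inl p.1, Sum.inl p.2} : Finset (Fin (3*m) ⊕ Fin t))))

/-- `F_sim(t)`: the 3-graph with hyperedges `f_1f_2f_3, f_1f_2f_4, f_3f_4f_5, f_5f_6f_7,
f_6f_7f_8` in which `f_8` is blown up to `t` copies. Here `inl 0, …, inl 6` play the roles
of `f_1, …, f_7` and the vertices `inr j` are the `t` copies of `f_8`. -/
def Fsim (t : ℕ) : Finset (Finset (Fin 7 ⊕ Fin t)) :=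
  ({({Sum.inl 0, Sum.inl 1, Sum.inl 2} : Finset (Fin 7 ⊕ Fin t)),
    ({Sum.inl 0, Sum.inl 1, Sum.inl 3} : Finset (Fin 7 ⊕ Fin t)),
    ({Sum.inl 2, Sum.inl 3, Sum.inl 4} : Finset (Fin 7 ⊕ Fin t)),
    ({Sum.inl 4, Sum.inl 5, Sum.inl 6} : Finset (Fin 7 ⊕ Fin t))} :
      Finset (Finset (Fin 7 ⊕ Fin t))) ∪
  Finset.univ.image (fun j : Fin t => ({Sum.inl 5, Sum.inl 6, Sum.inr j} : Finset (Fin 7 ⊕ Fin t)))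

/-- The 3-graph with parts `A`, `B`, `C` and an extra clique `X`: its hyperedges are the
triples with one vertex in each of `A`, `B`, `C`, all 3-subsets of `X`, and the triples with
one vertex in `X` and two vertices in a common part among `A`, `B`, `C`. -/
def simConstr (n : ℕ) (A B C X : Finset (Fin n)) : Finset (Finset (Fin n)) :=
  Finset.univ.filter (fun e => e.card = 3 ∧
    (((e ∩ A).card = 1 ∧ (e ∩ B).card = 1 ∧ (e ∩ C).card = 1) ∨
     e ⊆ X ∨
     ((e ∩ X).card = 1 ∧ ((e ∩ A).card = 2 ∨ (e ∩ B).card = 2 ∨ (e ∩ C).card = 2))))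

/-- `F_5^S(m)`: `T_3(3m,3)` together with one new vertex `v = inr ()` and one hyperedge
consisting of `v` and two vertices (`0` and `3`) lying in one part of `T_3(3m,3)`. -/
def F5Sm (m : ℕ) (hm : 2 ≤ m) : Finset (Finset (Fin (3*m) ⊕ Unit)) :=
  (T3 (3*m)).image (fun e => e.image Sum.inl) ∪
  {({Sum.inr (), Sum.inl ⟨0, by omega⟩, Sum.inl ⟨3, by omega⟩} : Finset (Fin (3*m) ⊕ Unit))}

/-- The disjoint union of `k` vertex-disjoint copies of the 3-graph `F`. -/
def copies (k : ℕ) {W : Type*} [DecidableEq W] (F : Finset (Finset W)) :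
    Finset (Finset (Fin k × W)) :=
  Finset.univ.biUnion (fun j : Fin k => F.image (fun e => e.image (fun w => (j, w))))

/-- The 3-graph `G(t,m,n)` (it does not depend on `m`): the vertices `v < t` form the set
`T`, the remaining `n - t` vertices carry a copy of `T_3(n-t,3)` (parts by residue of
`v - t` mod 3), and the hyperedges are those of this `T_3(n-t,3)` together with all
3-sets of vertices intersecting `T`. -/
def Gtmn (t n : ℕ) : Finset (Finset (Fin n)) :=
  Finset.univ.filter (fun e => e.card = 3 ∧
    ((∃ v ∈ e, (v : ℕ) < t) ∨
     (∀ i : Fin 3, (e.filter (fun v : Fin n => t ≤ (v : ℕ) ∧ ((v : ℕ) - t) % 3 = (i : ℕ))).card = 1)))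

/-- The blow-up of `F_5` in which every vertex is replaced by `t` copies:
the vertex `(i, j)` is the `j`-th copy of `f_{i+1}`. -/
def F5blowAll (t : ℕ) : Finset (Finset (Fin 5 × Fin t)) :=
  Finset.univ.biUnion (fun x : Fin t × Fin t × Fin t =>
    ({ ({((0:Fin 5), x.1), ((1:Fin 5), x.2.1), ((2:Fin 5), x.2.2)} : Finset (Fin 5 × Fin t)),
       ({((0:Fin 5), x.1), ((1:Fin 5), x.2.1), ((3:Fin 5), x.2.2)} : Finset (Fin 5 × Fin t)),
       ({((2:Fin 5), x.1), ((3:Fin 5), x.2.1), ((4:Fin 5), x.2.2)} : Finset (Fin 5 × Fin t)) } :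
      Finset (Finset (Fin 5 × Fin t))))

/-- The real-valued indicator of a proposition. -/
noncomputable def ind (p : Prop) : ℝ := open Classical in if p then 1 else 0

lemma ind_nonneg (p : Prop) : 0 ≤ ind p := by unfold ind; split_ifs <;> norm_num
lemma ind_le_one (p : Prop) : ind p ≤ 1 := by unfold ind; split_ifs <;> norm_num
lemma ind_of {p : Prop} (h : p) : ind p = 1 := by simp [ind, h]
lemma ind_of_not {p : Prop} (h : ¬ p) : ind p = 0 := by simp [ind, h]
lemma ind_and (p q : Prop) : ind (p ∧ q) = ind p * ind q := by
  by_cases hp : p <;> by_cases hq : q <;> simp [ind, hp, hq]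
lemma ind_pos_iff {p : Prop} : 0 < ind p ↔ p := by
  by_cases hp : p <;> simp [ind, hp]
lemma ind_congr {p q : Prop} (h : p ↔ q) : ind p = ind q := by rw [propext h]

lemma sum_ind_mem {Y : Type} [Fintype Y] (W : Finset Y) : ∑ y, ind (y ∈ W) = (W.card : ℝ) := by
  rw [← sum_subset (subset_univ W) fun y _ hy => ind_of_not hy, sum_congr rfl fun y hy => ind_of hy]
  simp

/-- If every `y ∈ W` is related to a proportion at least `c` of `X`, then some `s` elements of
`X` are simultaneously related to a proportion at least `(c / 2) ^ s` of `W`. -/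
lemma exists_common_of_degree {X Y : Type} [Fintype X] (R : X → Y → Prop)
    (c : ℝ) (hc : 0 < c) (hc1 : c ≤ 1) (hX : 0 < Fintype.card X)
    (W : Finset Y) (hW : ∀ y ∈ W, c * Fintype.card X ≤ ∑ x, ind (R x y)) (s : ℕ)
    (hs : 2 * (s : ℝ) ≤ c * Fintype.card X) :
    ∃ S : Finset X, S.card = s ∧ ∃ W' ⊆ W, (c / 2) ^ s * W.card ≤ (W'.card : ℝ) ∧
      ∀ x ∈ S, ∀ y ∈ W', R x y := by
  classical
  induction s with
  | zero => exact ⟨∅, rfl, W, Subset.rfl, by simp, by simp⟩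
  | succ s ih =>
    have hXr : (0 : ℝ) < Fintype.card X := by exact_mod_cast hX
    push_cast at hs
    obtain ⟨S, hS, W', hW', hcard, hR⟩ := ih (by linarith)
    have hne : (univ \ S).Nonempty := by
      rw [← card_pos, card_sdiff_of_subset (subset_univ _), hS, card_univ]
      have : (s : ℝ) < Fintype.card X := by nlinarith
      have : s < Fintype.card X := by exact_mod_cast this
      omega
    have key : ∑ _x ∈ univ \ S, (c / 2) * (W'.card : ℝ)
        ≤ ∑ x ∈ univ \ S, ∑ y ∈ W', ind (R x y) := by
      have h1 : ∀ y ∈ W', c / 2 * Fintype.card X ≤ ∑ x ∈ univ \ S, ind (R x y) := by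
        intro y hy
        have h2 := hW y (hW' hy)
        rw [← sum_sdiff (subset_univ S)] at h2
        have h3 : ∑ x ∈ S, ind (R x y) ≤ s := by
          calc _ ≤ ∑ x ∈ S, (1 : ℝ) := sum_le_sum fun _ _ => ind_le_one _
            _ = s := by simp [hS]
        linarith
      rw [sum_comm]
      calc _ = ((univ \ S).card : ℝ) * (c / 2 * W'.card) := by simp
        _ ≤ (Fintype.card X : ℝ) * (c / 2 * W'.card) := by
            gcongr
            exact card_le_univ _
        _ = ∑ y ∈ W', c / 2 * (Fintype.card X : ℝ) := by simp; ring
        _ ≤ _ := sum_le_sum h1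
    obtain ⟨x, hx, hxW⟩ := exists_le_of_sum_le hne key
    refine ⟨insert x S, ?_, W'.filter (fun y => R x y), (filter_subset _ _).trans hW', ?_, ?_⟩
    · rw [card_insert_of_notMem (by simpa using hx), hS]
    · have : ∑ y ∈ W', ind (R x y) = ((W'.filter (fun y => R x y)).card : ℝ) := by
        simp [ind]
      rw [← this, pow_succ]
      refine le_trans ?_ hxW
      have : 0 < c / 2 := by linarith
      nlinarith
    · intro z hz y hy
      rw [mem_filter] at hy
      rcases mem_insert.1 hz with rfl | hz
      · exact hy.2
      · exact hR z hz y hy.1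

/-- A dense bipartite relation contains an `s`-subset of the first side with many common
neighbours. -/
lemma exists_common (η : ℝ) (hη : 0 < η) (s : ℕ) :
    ∃ η' > 0, ∃ n0 : ℕ, ∀ (X Y : Type) [Fintype X] [Fintype Y] (R : X → Y → Prop),
      n0 ≤ Fintype.card X → η * (Fintype.card X * Fintype.card Y) ≤ ∑ y, ∑ x, ind (R x y) →
      ∃ S : Finset X, S.card = s ∧ η' * Fintype.card Y ≤ ∑ y, ind (∀ x ∈ S, R x y) := by
  classical
  wlog h1 : η ≤ 1 with H
  · obtain ⟨η', h', n0, h⟩ := H 1 one_pos s le_rfl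
    refine ⟨η', h', n0, fun X Y _ _ R hX hR => h X Y R hX (le_trans ?_ hR)⟩
    have : (0 : ℝ) ≤ Fintype.card X * Fintype.card Y := by positivity
    nlinarith
  refine ⟨(η / 2 / 2) ^ s * (η / 2), by positivity, ⌈4 * s / η⌉₊ + 1, ?_⟩
  intro X Y _ _ R hX hR
  have hX0 : 0 < Fintype.card X := by omega
  have hXr : (0 : ℝ) < Fintype.card X := by exact_mod_cast hX0
  have hs : 2 * (s : ℝ) ≤ η / 2 * Fintype.card X := by
    have : 4 * s / η ≤ (Fintype.card X : ℝ) := by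
      refine (Nat.le_ceil _).trans ?_
      exact_mod_cast (by omega : ⌈4 * s / η⌉₊ ≤ Fintype.card X)
    rw [div_le_iff₀ hη] at this
    linarith
  set W : Finset Y := univ.filter (fun y => η / 2 * Fintype.card X ≤ ∑ x, ind (R x y)) with hW
  obtain ⟨S, hS, W', hW', hcard, hSR⟩ := exists_common_of_degree R (η / 2) (by linarith)
    (by linarith) hX0 W (by intro y hy; simpa [hW] using hy) s hs
  refine ⟨S, hS, ?_⟩
  have hWc : η / 2 * Fintype.card Y ≤ (W.card : ℝ) := by
    have h2 : ∑ y, ∑ x, ind (R x y)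
        ≤ ∑ y, (Fintype.card X * ind (y ∈ W) + η / 2 * Fintype.card X) := by
      refine sum_le_sum fun y _ => ?_
      by_cases hy : y ∈ W
      · rw [ind_of hy]
        have : ∑ x, ind (R x y) ≤ Fintype.card X := by
          calc _ ≤ ∑ x : X, (1 : ℝ) := sum_le_sum fun _ _ => ind_le_one _
            _ = _ := by simp
        nlinarith
      · rw [ind_of_not hy]
        simp only [hW, mem_filter, mem_univ, true_and, not_le] at hy
        linarith
    have h3 := sum_ind_mem W
    rw [sum_add_distrib, ← mul_sum, h3] at h2
    simp only [sum_const, card_univ, nsmul_eq_mul] at h2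
    have h4 : Fintype.card X * (η / 2 * Fintype.card Y) ≤ Fintype.card X * (W.card : ℝ) := by
      nlinarith
    exact le_of_mul_le_mul_left h4 hXr
  calc _ = (η / 2 / 2) ^ s * (η / 2 * Fintype.card Y) := by ring
    _ ≤ (η / 2 / 2) ^ s * W.card := by gcongr
    _ ≤ W'.card := hcard
    _ = ∑ y ∈ W', (1 : ℝ) := by simp
    _ ≤ ∑ y ∈ W', ind (∀ x ∈ S, R x y) := sum_le_sum fun y hy => by
        rw [ind_of fun x hx => hSR x hx y hy]
    _ ≤ _ := sum_le_sum_of_subset_of_nonneg (subset_univ _) fun _ _ _ => ind_nonneg _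

/-- A dense 5-ary relation contains a complete 5-partite box with sides of size `s`. -/
lemma exists_box5 (η : ℝ) (hη : 0 < η) (s : ℕ) :
    ∃ n0 : ℕ, ∀ (V : Type) [Fintype V] (R : V → V → V → V → V → Prop),
      n0 ≤ Fintype.card V →
      η * (Fintype.card V : ℝ) ^ 5 ≤ ∑ a, ∑ b, ∑ c, ∑ d, ∑ e, ind (R a b c d e) →
      ∃ A B C D F : Finset V, A.card = s ∧ B.card = s ∧ C.card = s ∧ D.card = s ∧ F.card = s ∧
        ∀ a ∈ A, ∀ b ∈ B, ∀ c ∈ C, ∀ d ∈ D, ∀ e ∈ F, R a b c d e := by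
  obtain ⟨η1, h1, n1, H1⟩ := exists_common η hη s
  obtain ⟨η2, h2, n2, H2⟩ := exists_common η1 h1 s
  obtain ⟨η3, h3, n3, H3⟩ := exists_common η2 h2 s
  obtain ⟨η4, h4, n4, H4⟩ := exists_common η3 h3 s
  obtain ⟨η5, h5, n5, H5⟩ := exists_common η4 h4 s
  refine ⟨n1 + n2 + n3 + n4 + n5, fun V _ R hV hR => ?_⟩
  obtain ⟨F, hF, hF'⟩ := H1 V (V × V × V × V) (fun e p => R p.1 p.2.1 p.2.2.1 p.2.2.2 e)
    (by omega) (by simp only [Fintype.sum_prod_type, Fintype.card_prod]; push_cast; nlinarith)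
  obtain ⟨D, hD, hD'⟩ := H2 V (V × V × V) (fun d p => ∀ e ∈ F, R p.1 p.2.1 p.2.2 d e)
    (by omega) (by
      simp only [Fintype.sum_prod_type, Fintype.card_prod] at hF' ⊢; push_cast at *; nlinarith)
  obtain ⟨C, hC, hC'⟩ := H3 V (V × V) (fun c p => ∀ d ∈ D, ∀ e ∈ F, R p.1 p.2 c d e)
    (by omega) (by
      simp only [Fintype.sum_prod_type, Fintype.card_prod] at hD' ⊢; push_cast at *; nlinarith)
  obtain ⟨B, hB, hB'⟩ := H4 V V (fun b p => ∀ c ∈ C, ∀ d ∈ D, ∀ e ∈ F, R p b c d e)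
    (by omega) (by
      simp only [Fintype.sum_prod_type, Fintype.card_prod] at hC' ⊢; push_cast at *; nlinarith)
  obtain ⟨A, hA, hA'⟩ := H5 V Unit
    (fun a _ => ∀ b ∈ B, ∀ c ∈ C, ∀ d ∈ D, ∀ e ∈ F, R a b c d e)
    (by omega) (by simp only [Fintype.card_unit, univ_unique, sum_singleton]; push_cast at *; nlinarith)
  simp only [Fintype.card_unit, univ_unique, sum_singleton] at hA'
  have : ∀ a ∈ A, ∀ b ∈ B, ∀ c ∈ C, ∀ d ∈ D, ∀ e ∈ F, R a b c d e :=
    ind_pos_iff.1 (lt_of_lt_of_le (by push_cast; linarith) hA')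
  exact ⟨A, B, C, D, F, hA, hB, hC, hD, hF, this⟩

/-- A dense 4-ary relation contains a complete 4-partite box with sides of size `s`. -/
lemma exists_box4 (η : ℝ) (hη : 0 < η) (s : ℕ) (hs : 0 < s) :
    ∃ n0 : ℕ, ∀ (V : Type) [Fintype V] (R : V → V → V → V → Prop),
      n0 ≤ Fintype.card V →
      η * (Fintype.card V : ℝ) ^ 4 ≤ ∑ a, ∑ b, ∑ c, ∑ d, ind (R a b c d) →
      ∃ A B C D : Finset V, A.card = s ∧ B.card = s ∧ C.card = s ∧ D.card = s ∧
        ∀ a ∈ A, ∀ b ∈ B, ∀ c ∈ C, ∀ d ∈ D, R a b c d := by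
  obtain ⟨n0, H⟩ := exists_box5 η hη s
  refine ⟨n0, fun V _ R hV hR => ?_⟩
  obtain ⟨A, B, C, D, F, hA, hB, hC, hD, hF, h⟩ := H V (fun a b c d _ => R a b c d) hV (by
    simp only [sum_const, card_univ, nsmul_eq_mul, ← mul_sum]
    nlinarith [Nat.cast_nonneg (α := ℝ) (Fintype.card V)])
  obtain ⟨e, he⟩ := card_pos.1 (by omega : 0 < F.card)
  exact ⟨A, B, C, D, hA, hB, hC, hD, fun a ha b hb c hc d hd => h a ha b hb c hc d hd e he⟩

/-- A dense ternary relation contains a complete 3-partite box with sides of size `s`. -/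
lemma exists_box3 (η : ℝ) (hη : 0 < η) (s : ℕ) (hs : 0 < s) :
    ∃ n0 : ℕ, ∀ (V : Type) [Fintype V] (R : V → V → V → Prop),
      n0 ≤ Fintype.card V →
      η * (Fintype.card V : ℝ) ^ 3 ≤ ∑ a, ∑ b, ∑ c, ind (R a b c) →
      ∃ A B C : Finset V, A.card = s ∧ B.card = s ∧ C.card = s ∧
        ∀ a ∈ A, ∀ b ∈ B, ∀ c ∈ C, R a b c := by
  obtain ⟨n0, H⟩ := exists_box4 η hη s hs
  refine ⟨n0, fun V _ R hV hR => ?_⟩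
  obtain ⟨A, B, C, D, hA, hB, hC, hD, h⟩ := H V (fun a b c _ => R a b c) hV (by
    simp only [sum_const, card_univ, nsmul_eq_mul, ← mul_sum]
    nlinarith [Nat.cast_nonneg (α := ℝ) (Fintype.card V)])
  obtain ⟨d, hd⟩ := card_pos.1 (by omega : 0 < D.card)
  exact ⟨A, B, C, hA, hB, hC, fun a ha b hb c hc => h a ha b hb c hc d hd⟩

/-- `E` is the adjacency relation of a 3-graph: symmetric, and relating only distinct vertices. -/
structure IsTriple {V : Type} (E : V → V → V → Prop) : Prop where
  swap12 : ∀ {x y z}, E x y z → E y x z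
  swap23 : ∀ {x y z}, E x y z → E x z y
  ne12 : ∀ {x y z}, E x y z → x ≠ y

namespace IsTriple
variable {V : Type} {E : V → V → V → Prop}
lemma ne13 (hE : IsTriple E) {x y z} (h : E x y z) : x ≠ z := hE.ne12 (hE.swap23 h)
lemma ne23 (hE : IsTriple E) {x y z} (h : E x y z) : y ≠ z := hE.ne13 (hE.swap12 h)
lemma rot (hE : IsTriple E) {x y z} (h : E x y z) : E y z x := hE.swap23 (hE.swap12 h)
lemma comap {W : Type} (hE : IsTriple E) (f : W ↪ V) : IsTriple (fun x y z => E (f x) (f y) (f z)) :=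
  ⟨fun h => hE.swap12 h, fun h => hE.swap23 h, fun h e => hE.ne12 h (congrArg f e)⟩
end IsTriple

/-- `U` is the vertex set of a copy of `F_5^S(m)` in the 3-graph `E`. -/
def IsCop {V : Type} (E : V → V → V → Prop) (m : ℕ) (U : Finset V) : Prop :=
  ∃ (A B C : Finset V) (w a a' : V), A.card = m ∧ B.card = m ∧ C.card = m ∧
    (∀ x ∈ A, ∀ y ∈ B, ∀ z ∈ C, E x y z) ∧ a ∈ A ∧ a' ∈ A ∧ a ≠ a' ∧
    w ∉ A ∧ w ∉ B ∧ w ∉ C ∧ E a a' w ∧ ∀ x, x ∈ U ↔ x ∈ A ∨ x ∈ B ∨ x ∈ C ∨ x = w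

/-- The vertex set `X` spans no copy of `F_5^S(m)` in `E`. -/
def CopFree {V : Type} (E : V → V → V → Prop) (m : ℕ) (X : Finset V) : Prop :=
  ∀ U ⊆ X, ¬ IsCop E m U

lemma not_copFree {V : Type} {E : V → V → V → Prop} (hE : IsTriple E) {m : ℕ} (hm : 2 ≤ m)
    {X A B C : Finset V} (hA : m + 1 ≤ A.card) (hB : m + 1 ≤ B.card) (hC : m + 1 ≤ C.card)
    (hAX : A ⊆ X) (hBX : B ⊆ X) (hCX : C ⊆ X)
    (h : ∀ x ∈ A, ∀ y ∈ B, ∀ z ∈ C, E x y z) {a a' w : V} (ha : a ∈ A) (ha' : a' ∈ A)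
    (hw : w ∈ X) (he : E a a' w) : ¬ CopFree E m X := by
  classical
  intro hfree
  have haa : ({a, a'} : Finset V).card = 2 := card_pair (hE.ne12 he)
  obtain ⟨A', hA1, hA2, hA3⟩ := exists_subsuperset_card_eq (s := {a, a'}) (t := A.erase w) (n := m)
    (by
      intro x hx
      simp only [mem_insert, mem_singleton] at hx
      rw [mem_erase]
      rcases hx with rfl | rfl
      · exact ⟨hE.ne13 he, ha⟩
      · exact ⟨hE.ne23 he, ha'⟩)
    (by omega) (by have := pred_card_le_card_erase (s := A) (a := w); omega)
  obtain ⟨B', hB2, hB3⟩ := exists_subset_card_eq (s := B.erase w) (n := m)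
    (by have := pred_card_le_card_erase (s := B) (a := w); omega)
  obtain ⟨C', hC2, hC3⟩ := exists_subset_card_eq (s := C.erase w) (n := m)
    (by have := pred_card_le_card_erase (s := C) (a := w); omega)
  refine hfree (A' ∪ B' ∪ C' ∪ {w}) ?_ ⟨A', B', C', w, a, a', hA3, hB3, hC3, ?_, hA1 (by simp),
    hA1 (by simp), hE.ne12 he, fun h => by simpa using hA2 h, fun h => by simpa using hB2 h,
    fun h => by simpa using hC2 h, he, fun x => by
      simp only [mem_union, mem_singleton, or_assoc]⟩
  · refine union_subset (union_subset (union_subset ?_ ?_) ?_) (by simpa using hw)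
    · exact hA2.trans ((erase_subset _ _).trans hAX)
    · exact hB2.trans ((erase_subset _ _).trans hBX)
    · exact hC2.trans ((erase_subset _ _).trans hCX)
  · exact fun x hx y hy z hz => h x (erase_subset _ _ (hA2 hx)) y (erase_subset _ _ (hB2 hy)) z
      (erase_subset _ _ (hC2 hz))

/-- A copy-free 3-graph has few copies of `F_5`. -/
lemma CopFree.few_five {m : ℕ} (hm : 2 ≤ m) (η : ℝ) (hη : 0 < η) :
    ∃ n0 : ℕ, ∀ (V : Type) [Fintype V] (E : V → V → V → Prop), IsTriple E → CopFree E m univ →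
      n0 ≤ Fintype.card V →
      ∑ x, ∑ y, ∑ u, ∑ v, ∑ w, ind (E x y u ∧ E x y v ∧ E u v w)
        ≤ η * (Fintype.card V : ℝ) ^ 5 := by
  classical
  obtain ⟨n0, H⟩ := exists_box5 η hη (m + 1)
  refine ⟨n0, fun V _ E hE hF hV => ?_⟩
  by_contra! hcon
  obtain ⟨A, B, C, D, F, hA, hB, hC, hD, hF', h⟩ := H V _ hV hcon.le
  obtain ⟨x, hx⟩ := card_pos.1 (by omega : 0 < A.card)
  obtain ⟨y, hy⟩ := card_pos.1 (by omega : 0 < B.card)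
  obtain ⟨u, hu⟩ := card_pos.1 (by omega : 0 < C.card)
  obtain ⟨v, hv⟩ := card_pos.1 (by omega : 0 < D.card)
  obtain ⟨w, hw⟩ := card_pos.1 (by omega : 0 < F.card)
  refine not_copFree hE hm (A := C ∪ D) (B := A) (C := B) (X := univ)
    (by have := card_le_card (subset_union_left : C ⊆ C ∪ D); omega) (by omega)
    (by omega) (subset_univ _) (subset_univ _) (subset_univ _) ?_ (a := u) (a' := v) (w := w)
    (mem_union_left _ hu) (mem_union_right _ hv) (mem_univ _)
    (h x hx y hy u hu v hv w hw).2.2 hF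
  intro c hc a ha b hb
  rcases mem_union.1 hc with hc | hc
  · exact hE.rot (hE.rot (h a ha b hb c hc v hv w hw).1)
  · exact hE.rot (hE.rot (h a ha b hb u hu c hc w hw).2.1)

/-- A copy-free 3-graph has few copies of `K_4^-`. -/
lemma CopFree.few_four {m : ℕ} (hm : 2 ≤ m) (η : ℝ) (hη : 0 < η) :
    ∃ n0 : ℕ, ∀ (V : Type) [Fintype V] (E : V → V → V → Prop), IsTriple E → CopFree E m univ →
      n0 ≤ Fintype.card V →
      ∑ x, ∑ y, ∑ z, ∑ w, ind (E x y z ∧ E x y w ∧ E x z w)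
        ≤ η * (Fintype.card V : ℝ) ^ 4 := by
  classical
  obtain ⟨n0, H⟩ := exists_box4 η hη (m + 1) (by omega)
  refine ⟨n0, fun V _ E hE hF hV => ?_⟩
  by_contra! hcon
  obtain ⟨A, B, C, D, hA, hB, hC, hD, h⟩ := H V _ hV hcon.le
  obtain ⟨x, hx⟩ := card_pos.1 (by omega : 0 < A.card)
  obtain ⟨y, hy⟩ := card_pos.1 (by omega : 0 < B.card)
  obtain ⟨z, hz⟩ := card_pos.1 (by omega : 0 < C.card)
  obtain ⟨w, hw⟩ := card_pos.1 (by omega : 0 < D.card)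
  refine not_copFree hE hm (A := C ∪ D) (B := A) (C := B) (X := univ)
    (by have := card_le_card (subset_union_left : C ⊆ C ∪ D); omega) (by omega)
    (by omega) (subset_univ _) (subset_univ _) (subset_univ _) ?_ (a := z) (a' := w) (w := x)
    (mem_union_left _ hz) (mem_union_right _ hw) (mem_univ _)
    (hE.rot (h x hx y hy z hz w hw).2.2) hF
  intro c hc a ha b hb
  rcases mem_union.1 hc with hc | hc
  · exact hE.rot (hE.rot (h a ha b hb c hc w hw).1)
  · exact hE.rot (hE.rot (h a ha b hb z hz c hc).2.1)

section Local
variable {V : Type} [Fintype V] (E : V → V → V → Prop)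

/-- The codegree of a pair of vertices. -/
noncomputable def cod (x y : V) : ℝ := ∑ z, ind (E x y z)

/-- The number of copies of `F_5` in which `x`, `y` play the roles of `f_1`, `f_2`. -/
noncomputable def fiveAt (x y : V) : ℝ := ∑ u, ∑ v, ∑ w, ind (E x y u ∧ E x y v ∧ E u v w)

/-- The number of triangles in the link of `s`. -/
noncomputable def triAt (s : V) : ℝ := ∑ y, ∑ z, ∑ w, ind (E s y z ∧ E s y w ∧ E s z w)

lemma cod_nonneg (x y : V) : 0 ≤ cod E x y := sum_nonneg fun _ _ => ind_nonneg _

lemma fiveAt_nonneg (x y : V) : 0 ≤ fiveAt E x y :=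
  sum_nonneg fun _ _ => sum_nonneg fun _ _ => sum_nonneg fun _ _ => ind_nonneg _

lemma triAt_nonneg (x : V) : 0 ≤ triAt E x :=
  sum_nonneg fun _ _ => sum_nonneg fun _ _ => sum_nonneg fun _ _ => ind_nonneg _

lemma sum_ind_mul {Y : Type} [Fintype Y] (P : Y → Prop) [DecidablePred P] (f : Y → ℝ) :
    ∑ y, ind (P y) * f y = ∑ y ∈ univ.filter P, f y := by
  rw [sum_filter]
  refine sum_congr rfl fun y _ => ?_
  by_cases h : P y <;> simp [ind, h]

lemma sum_ind_filter {Y : Type} [Fintype Y] (P : Y → Prop) [DecidablePred P] :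
    ∑ y, ind (P y) = ((univ.filter P).card : ℝ) := by
  have := sum_ind_mul P (fun _ => 1)
  simpa using this

lemma fiveAt_eq (x y : V) [DecidablePred (E x y)] :
    fiveAt E x y = ∑ u ∈ univ.filter (E x y), ∑ v ∈ univ.filter (E x y), cod E u v := by
  rw [← sum_ind_mul]
  refine sum_congr rfl fun u _ => ?_
  rw [← sum_ind_mul, mul_sum]
  refine sum_congr rfl fun v _ => ?_
  rw [cod, mul_sum, mul_sum]
  refine sum_congr rfl fun w _ => ?_
  rw [ind_and, ind_and]

/-- In a 3-graph with large minimum degree and few copies of `F_5` and `K_4^-`, there are a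
nearly independent set `S` of almost maximum codegree type and a vertex `s ∈ S` whose link is
well behaved. -/
lemma exists_good_vertex (τ : ℝ) (hτ : 0 < τ) (hτ1 : τ ≤ 1 / 27) (hV : 0 < Fintype.card V)
    (hdeg : ∀ x, (2 / 9 - τ) * (Fintype.card V : ℝ) ^ 2 ≤ ∑ y, cod E x y)
    (h5 : ∑ x, ∑ y, fiveAt E x y ≤ τ ^ 2 / 729 * (Fintype.card V : ℝ) ^ 5)
    (h4 : ∑ x, triAt E x ≤ τ ^ 2 / 729 * (Fintype.card V : ℝ) ^ 4) :
    ∃ (S : Finset V) (s : V) (p : V → ℝ),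
      ∑ u ∈ S, ∑ v ∈ S, cod E u v ≤ τ * (Fintype.card V : ℝ) ^ 3 ∧
      triAt E s ≤ τ * (Fintype.card V : ℝ) ^ 3 ∧
      ∑ w, fiveAt E s w ≤ τ * (Fintype.card V : ℝ) ^ 4 ∧
      ∑ v ∈ S, cod E s v ≤ τ * (Fintype.card V : ℝ) ^ 2 ∧
      (∀ w, cod E s w ≤ S.card + p w) ∧ (∀ w, 0 ≤ p w) ∧
      ∑ w, p w ≤ τ * (Fintype.card V : ℝ) ^ 2 := by
  classical
  set N : ℝ := (Fintype.card V : ℝ) with hN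
  have hN0 : 0 < N := by rw [hN]; exact_mod_cast hV
  have : Nonempty V := Fintype.card_pos_iff.1 hV
  set Λ : ℝ := 27 / τ with hΛ
  have hΛ0 : 0 < Λ := by positivity
  have hΛτ : Λ * τ = 27 := by rw [hΛ]; field_simp
  set φ : V × V → ℝ := fun q => cod E q.1 q.2 - Λ * fiveAt E q.1 q.2 / N ^ 2 with hφ
  obtain ⟨⟨x, y⟩, -, hmax⟩ := exists_max_image (univ : Finset (V × V)) φ univ_nonempty
  have hφsum : N ^ 3 / 9 ≤ ∑ q, φ q := by
    simp only [hφ, Fintype.sum_prod_type, sum_sub_distrib, ← sum_div, ← mul_sum]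
    have h1 : N * ((2 / 9 - τ) * N ^ 2) ≤ ∑ x, ∑ y, cod E x y := by
      calc _ = ∑ x : V, (2 / 9 - τ) * N ^ 2 := by simp [hN]
        _ ≤ _ := sum_le_sum fun x _ => hdeg x
    have h2 : Λ * (∑ x, ∑ y, fiveAt E x y) / N ^ 2 ≤ τ / 27 * N ^ 3 := by
      rw [div_le_iff₀ (by positivity)]
      calc _ ≤ Λ * (τ ^ 2 / 729 * N ^ 5) := by gcongr
        _ = (Λ * τ) * (τ / 729 * N ^ 5) := by ring
        _ = τ / 27 * N ^ 3 * N ^ 2 := by rw [hΛτ]; ring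
    nlinarith [pow_pos hN0 3]
  have hk : N / 9 ≤ φ (x, y) := by
    have : ∑ q, φ q ≤ N ^ 2 * φ (x, y) := by
      calc _ ≤ ∑ q : V × V, φ (x, y) := sum_le_sum fun q _ => hmax q (mem_univ q)
        _ = _ := by
          simp only [sum_const, card_univ, Fintype.card_prod, nsmul_eq_mul]
          push_cast
          ring
    have h2 : N ^ 2 * (N / 9) ≤ N ^ 2 * φ (x, y) := by nlinarith
    exact le_of_mul_le_mul_left h2 (by positivity)
  set S := univ.filter (E x y) with hS
  have hScard : cod E x y = S.card := by rw [cod, sum_ind_filter]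
  have hφS : φ (x, y) ≤ S.card := by
    rw [← hScard]
    have : 0 ≤ Λ * fiveAt E x y / N ^ 2 := by have := fiveAt_nonneg E x y; positivity
    simp only [hφ]; linarith
  have hSN : (S.card : ℝ) ≤ N := by rw [hN]; exact_mod_cast card_le_univ _
  have hbad : fiveAt E x y ≤ τ / 27 * N ^ 3 := by
    have h1 : Λ * fiveAt E x y / N ^ 2 ≤ N := by
      have h : φ (x, y) = S.card - Λ * fiveAt E x y / N ^ 2 := by rw [← hScard]
      linarith [div_pos hN0 (show (0 : ℝ) < 9 by norm_num)]
    rw [div_le_iff₀ (by positivity)] at h1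
    have h2 : τ * (Λ * fiveAt E x y) ≤ τ * (N * N ^ 2) := by gcongr
    have h3 : τ * (Λ * fiveAt E x y) = 27 * fiveAt E x y := by rw [← hΛτ]; ring
    linarith
  have hsum : ∑ s ∈ S, (N * triAt E s + Λ * ∑ w, fiveAt E s w + N ^ 2 * ∑ v ∈ S, cod E s v)
      ≤ ∑ s ∈ S, τ * N ^ 4 := by
    rw [sum_add_distrib, sum_add_distrib, ← mul_sum, ← mul_sum, ← mul_sum, sum_const,
      nsmul_eq_mul]
    have h1 : ∑ s ∈ S, triAt E s ≤ τ ^ 2 / 729 * N ^ 4 := le_trans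
      (sum_le_sum_of_subset_of_nonneg (subset_univ _) fun s _ _ => triAt_nonneg E s) h4
    have h2 : ∑ s ∈ S, ∑ w, fiveAt E s w ≤ τ ^ 2 / 729 * N ^ 5 := le_trans
      (sum_le_sum_of_subset_of_nonneg (subset_univ _) fun s _ _ =>
        sum_nonneg fun w _ => fiveAt_nonneg E s w) h5
    have h3 : ∑ s ∈ S, ∑ v ∈ S, cod E s v ≤ τ / 27 * N ^ 3 := by rw [← fiveAt_eq]; exact hbad
    have h4' : N / 9 * (τ * N ^ 4) ≤ S.card * (τ * N ^ 4) := by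
      gcongr; linarith
    calc _ ≤ N * (τ ^ 2 / 729 * N ^ 4) + Λ * (τ ^ 2 / 729 * N ^ 5)
          + N ^ 2 * (τ / 27 * N ^ 3) := by gcongr
      _ = (τ ^ 2 / 729 + Λ * τ * τ / 729 + τ / 27) * N ^ 5 := by ring
      _ = (τ ^ 2 / 729 + 2 * τ / 27) * N ^ 5 := by rw [hΛτ]; ring
      _ ≤ τ / 9 * N ^ 5 := by gcongr; nlinarith
      _ = N / 9 * (τ * N ^ 4) := by ring
      _ ≤ _ := h4'
  have hSne : S.Nonempty := by
    rw [← card_pos]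
    have : (0 : ℝ) < S.card := by linarith [div_pos hN0 (show (0 : ℝ) < 9 by norm_num)]
    exact_mod_cast this
  obtain ⟨s, hsS, hs⟩ := exists_le_of_sum_le hSne hsum
  have t1 : 0 ≤ N * triAt E s := mul_nonneg hN0.le (triAt_nonneg E s)
  have t2' : 0 ≤ ∑ w, fiveAt E s w := sum_nonneg fun w _ => fiveAt_nonneg E s w
  have t2 : 0 ≤ Λ * ∑ w, fiveAt E s w := mul_nonneg hΛ0.le t2'
  have t3 : 0 ≤ N ^ 2 * ∑ v ∈ S, cod E s v :=
    mul_nonneg (by positivity) (sum_nonneg fun w _ => cod_nonneg E s w)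
  refine ⟨S, s, fun w => Λ * fiveAt E s w / N ^ 2, ?_, ?_, ?_, ?_, ?_, ?_, ?_⟩
  · rw [← fiveAt_eq]
    refine hbad.trans ?_
    gcongr
    linarith
  · exact le_of_mul_le_mul_left (by linarith : N * triAt E s ≤ N * (τ * N ^ 3)) hN0
  · have : 1 ≤ Λ := by rw [hΛ, le_div_iff₀ hτ]; linarith
    nlinarith
  · exact le_of_mul_le_mul_left
      (by linarith : N ^ 2 * ∑ v ∈ S, cod E s v ≤ N ^ 2 * (τ * N ^ 2)) (by positivity)
  · intro w
    have h1 := hmax (s, w) (mem_univ _)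
    simp only [hφ] at h1 hφS
    linarith
  · intro w
    have := fiveAt_nonneg E s w
    positivity
  · rw [← sum_div, ← mul_sum, div_le_iff₀ (by positivity)]
    linarith

end Local

section Local
variable {V : Type} [Fintype V] {E : V → V → V → Prop}

/-- The number of edges whose three vertices receive the colours `i`, `j`, `k`, in this order. -/
noncomputable def rainbow (E : V → V → V → Prop) (χ : V → Fin 3) (i j k : Fin 3) : ℝ :=
  ∑ x, ∑ y, ∑ z, ind (χ x = i ∧ χ y = j ∧ χ z = k ∧ E x y z)

lemma rainbow_swap12 (hE : IsTriple E) (χ : V → Fin 3) (i j k : Fin 3) :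
    rainbow E χ i j k = rainbow E χ j i k := by
  unfold rainbow
  rw [sum_comm]
  refine sum_congr rfl fun x _ => sum_congr rfl fun y _ => sum_congr rfl fun z _ => ind_congr ?_
  have := @hE.swap12 x y z
  have := @hE.swap12 y x z
  tauto

lemma rainbow_swap23 (hE : IsTriple E) (χ : V → Fin 3) (i j k : Fin 3) :
    rainbow E χ i j k = rainbow E χ i k j := by
  unfold rainbow
  refine sum_congr rfl fun x _ => ?_
  rw [sum_comm]
  refine sum_congr rfl fun y _ => sum_congr rfl fun z _ => ind_congr ?_
  have := @hE.swap23 x y z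
  have := @hE.swap23 x z y
  tauto

lemma sum_le_rainbow (hE : IsTriple E) (χ : V → Fin 3) :
    ∑ x, ∑ y, cod E x y
      ≤ 6 * rainbow E χ 0 1 2 + 3 * ∑ x, ∑ y, ind (χ x = χ y) * cod E x y := by
  have h021 := rainbow_swap23 hE χ 0 2 1
  have h102 := rainbow_swap12 hE χ 1 0 2
  have h120 := rainbow_swap23 hE χ 1 2 0
  have h201 := rainbow_swap12 hE χ 2 0 1
  have h210 := rainbow_swap12 hE χ 2 1 0
  have hs1 : ∑ x, ∑ y, ind (χ x = χ y) * cod E x y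
      = ∑ x, ∑ y, ∑ z, ind (χ x = χ y) * ind (E x y z) := by
    simp only [cod, mul_sum]
  have hs2 : ∑ x, ∑ y, ind (χ x = χ y) * cod E x y
      = ∑ x, ∑ y, ∑ z, ind (χ x = χ z) * ind (E x y z) := by
    rw [hs1]
    refine sum_congr rfl fun x _ => ?_
    rw [sum_comm]
    exact sum_congr rfl fun y _ => sum_congr rfl fun z _ => by
      rw [ind_congr ⟨hE.swap23, hE.swap23⟩]
  have hs3 : ∑ x, ∑ y, ind (χ x = χ y) * cod E x y
      = ∑ x, ∑ y, ∑ z, ind (χ y = χ z) * ind (E x y z) := by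
    rw [hs2, sum_comm]
    exact sum_congr rfl fun x _ => sum_congr rfl fun y _ => sum_congr rfl fun z _ => by
      rw [ind_congr ⟨hE.swap12, hE.swap12⟩]
  have hpt : ∑ x, ∑ y, cod E x y ≤
      (rainbow E χ 0 1 2 + rainbow E χ 0 2 1 + rainbow E χ 1 0 2 + rainbow E χ 1 2 0 +
        rainbow E χ 2 0 1 + rainbow E χ 2 1 0) +
      (∑ x, ∑ y, ∑ z, ind (χ x = χ y) * ind (E x y z) +
       ∑ x, ∑ y, ∑ z, ind (χ x = χ z) * ind (E x y z) +
       ∑ x, ∑ y, ∑ z, ind (χ y = χ z) * ind (E x y z)) := by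
    simp only [cod, rainbow, ← sum_add_distrib]
    refine sum_le_sum fun x _ => sum_le_sum fun y _ => sum_le_sum fun z _ => ?_
    by_cases h : E x y z
    · simp only [h, and_true]
      generalize χ x = a
      generalize χ y = b
      generalize χ z = c
      fin_cases a <;> fin_cases b <;> fin_cases c <;> simp [ind]
    · rw [ind_of_not h]
      simp [ind_of_not, h]
  linarith

/-- Three disjoint nearly independent sets covering almost all vertices of a dense 3-graph give a
colouring with many rainbow edges. -/
lemma exists_coloring_of_parts (hE : IsTriple E) (A B C : Finset V) (hAB : Disjoint A B)
    (hAC : Disjoint A C) (hBC : Disjoint B C) (α β : ℝ)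
    (hA : ∑ x ∈ A, ∑ y ∈ A, cod E x y ≤ α * (Fintype.card V : ℝ) ^ 3)
    (hB : ∑ x ∈ B, ∑ y ∈ B, cod E x y ≤ α * (Fintype.card V : ℝ) ^ 3)
    (hC : ∑ x ∈ C, ∑ y ∈ C, cod E x y ≤ α * (Fintype.card V : ℝ) ^ 3)
    (hD : (1 - α) * (Fintype.card V : ℝ) ≤ A.card + B.card + C.card)
    (htot : β * (Fintype.card V : ℝ) ^ 3 ≤ ∑ x, ∑ y, cod E x y) :
    ∃ χ : V → Fin 3, (β - 15 * α) / 6 * (Fintype.card V : ℝ) ^ 3 ≤ rainbow E χ 0 1 2 := by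
  classical
  set N : ℝ := (Fintype.card V : ℝ) with hN
  have hN0 : 0 ≤ N := by positivity
  set D : Finset V := univ \ (A ∪ B ∪ C) with hDdef
  have hDc : (D.card : ℝ) ≤ α * N := by
    have h1 : D.card + (A ∪ B ∪ C).card = Fintype.card V := by
      rw [hDdef, card_sdiff_add_card_eq_card (subset_univ _), card_univ]
    rw [card_union_of_disjoint (by rw [disjoint_union_left]; exact ⟨hAC, hBC⟩),
      card_union_of_disjoint hAB] at h1
    have h2 : (D.card : ℝ) + (A.card + B.card + C.card) = N := by rw [hN, ← h1]; push_cast; ring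
    linarith
  refine ⟨fun v => if v ∈ B then 1 else if v ∈ C then 2 else 0, ?_⟩
  set χ : V → Fin 3 := fun v => if v ∈ B then 1 else if v ∈ C then 2 else 0 with hχ
  have hcodN : ∀ x y, cod E x y ≤ N := fun x y => by
    calc cod E x y ≤ ∑ z : V, (1 : ℝ) := sum_le_sum fun _ _ => ind_le_one _
      _ = N := by simp [hN]
  have hset : ∀ S : Finset V, ∑ x, ∑ y, ind (x ∈ S ∧ y ∈ S) * cod E x y
      = ∑ x ∈ S, ∑ y ∈ S, cod E x y := by
    intro S
    have : ∀ x, ∑ y, ind (x ∈ S ∧ y ∈ S) * cod E x y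
        = ind (x ∈ S) * ∑ y, ind (y ∈ S) * cod E x y := by
      intro x
      rw [mul_sum]
      exact sum_congr rfl fun y _ => by rw [ind_and, mul_assoc]
    simp only [this, sum_ind_mul]
    simp
  have hDs : ∑ x : V, ∑ _y : V, ind (x ∈ D) * N = D.card * N ^ 2 := by
    simp only [sum_const, card_univ, nsmul_eq_mul, ← mul_sum, ← sum_mul, sum_ind_mem, ← hN]
    ring
  have hDs' : ∑ _x : V, ∑ y : V, ind (y ∈ D) * N = D.card * N ^ 2 := by
    rw [sum_comm, hDs]
  have hsame : ∑ x, ∑ y, ind (χ x = χ y) * cod E x y ≤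
      ∑ x, ∑ y, ind (x ∈ A ∧ y ∈ A) * cod E x y + ∑ x, ∑ y, ind (x ∈ B ∧ y ∈ B) * cod E x y +
      ∑ x, ∑ y, ind (x ∈ C ∧ y ∈ C) * cod E x y + ∑ x : V, ∑ _y : V, ind (x ∈ D) * N +
      ∑ _x : V, ∑ y : V, ind (y ∈ D) * N := by
    simp only [← sum_add_distrib]
    refine sum_le_sum fun x _ => sum_le_sum fun y _ => ?_
    have hc0 := cod_nonneg E x y
    have hc1 := hcodN x y
    have n1 := mul_nonneg (ind_nonneg (x ∈ A ∧ y ∈ A)) hc0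
    have n2 := mul_nonneg (ind_nonneg (x ∈ B ∧ y ∈ B)) hc0
    have n3 := mul_nonneg (ind_nonneg (x ∈ C ∧ y ∈ C)) hc0
    have n4 := mul_nonneg (ind_nonneg (x ∈ D)) hN0
    have n5 := mul_nonneg (ind_nonneg (y ∈ D)) hN0
    by_cases hxy : χ x = χ y
    · rw [ind_of hxy, one_mul]
      by_cases hxD : x ∈ D
      · rw [ind_of hxD] at n4 ⊢; linarith
      by_cases hyD : y ∈ D
      · rw [ind_of hyD] at n5 ⊢; linarith
      have hx : x ∈ A ∨ x ∈ B ∨ x ∈ C := by simp [hDdef] at hxD; tauto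
      have hy : y ∈ A ∨ y ∈ B ∨ y ∈ C := by simp [hDdef] at hyD; tauto
      have : (x ∈ A ∧ y ∈ A) ∨ (x ∈ B ∧ y ∈ B) ∨ (x ∈ C ∧ y ∈ C) := by
        have a1 : x ∈ B → x ∉ C := fun h h' => disjoint_left.1 hBC h h'
        have a2 : y ∈ B → y ∉ C := fun h h' => disjoint_left.1 hBC h h'
        simp only [hχ] at hxy
        split_ifs at hxy with c1 c2 c3 c4 c5 c6 c7 c8 <;> simp_all
      rcases this with h | h | h
      · rw [ind_of h] at n1 ⊢; linarith
      · rw [ind_of h] at n2 ⊢; linarith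
      · rw [ind_of h] at n3 ⊢; linarith
    · rw [ind_of_not hxy]; linarith
  rw [hset, hset, hset, hDs, hDs'] at hsame
  have hfin := sum_le_rainbow hE χ
  have : (D.card : ℝ) * N ^ 2 ≤ α * N * N ^ 2 := by gcongr
  nlinarith

end Local

section Local
variable {V : Type} [Fintype V] {E : V → V → V → Prop}

set_option maxHeartbeats 1600000 in
/-- In a 3-graph with large minimum degree and few copies of `F_5` and `K_4^-`, some 3-colouring
makes almost the maximum possible number of edges rainbow. -/
lemma exists_coloring_of_few (hE : IsTriple E) (τ : ℝ) (hτ : 0 < τ) (hτ1 : τ ≤ 1 / 27)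
    (hV : 0 < Fintype.card V)
    (hdeg : ∀ x, (2 / 9 - τ) * (Fintype.card V : ℝ) ^ 2 ≤ ∑ y, cod E x y)
    (h5 : ∑ x, ∑ y, fiveAt E x y ≤ τ ^ 2 / 729 * (Fintype.card V : ℝ) ^ 5)
    (h4 : ∑ x, triAt E x ≤ τ ^ 2 / 729 * (Fintype.card V : ℝ) ^ 4) :
    ∃ χ : V → Fin 3, (1 / 27 - 451 * τ) * (Fintype.card V : ℝ) ^ 3 ≤ rainbow E χ 0 1 2 := by
  classical
  obtain ⟨S, s, p, hS, hT, hF, hcS, hcod, hp0, hp⟩ := exists_good_vertex E τ hτ hτ1 hV hdeg h5 h4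
  set N : ℝ := (Fintype.card V : ℝ) with hN
  have hN0 : 0 < N := by rw [hN]; exact_mod_cast hV
  set g : V → V → ℝ := fun y z => ind (E s y z) with hg
  have hgs : ∀ y z, g y z = g z y := fun y z => ind_congr ⟨hE.swap23, hE.swap23⟩
  have hg0 : ∀ y z, 0 ≤ g y z := fun y z => ind_nonneg _
  set U : Finset V := univ \ S with hU
  have hUS : (U.card : ℝ) + S.card = N := by
    rw [hN, ← card_univ, ← card_sdiff_add_card_eq_card (subset_univ S)]; push_cast; rfl
  set u : ℝ := (U.card : ℝ) with hu
  set d : V → ℝ := fun y => ∑ z ∈ U, g y z with hd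
  set D : ℝ := ∑ y ∈ U, d y with hD
  have hsplit : ∀ f : V → ℝ, ∑ y, f y = ∑ y ∈ U, f y + ∑ y ∈ S, f y := fun f => by
    rw [hU, sum_sdiff (subset_univ S)]
  have hDlow : (2 / 9 - 3 * τ) * N ^ 2 ≤ D := by
    have h1 := hdeg s
    have h2 : ∑ y, cod E s y = ∑ y ∈ U, ∑ z, g y z + ∑ y ∈ S, cod E s y := hsplit _
    have h3 : ∑ y ∈ U, ∑ z, g y z = D + ∑ y ∈ U, ∑ z ∈ S, g y z := by
      rw [hD, ← sum_add_distrib]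
      exact sum_congr rfl fun y _ => hsplit _
    have h4 : ∑ y ∈ U, ∑ z ∈ S, g y z ≤ ∑ z ∈ S, cod E s z := by
      rw [sum_comm]
      refine sum_le_sum fun z _ => ?_
      calc ∑ y ∈ U, g y z = ∑ y ∈ U, g z y := sum_congr rfl fun y _ => hgs _ _
        _ ≤ ∑ y, g z y := sum_le_sum_of_subset_of_nonneg (subset_univ _) fun _ _ _ => hg0 _ _
    nlinarith
  have hD9 : N ^ 2 / 9 ≤ D := by nlinarith [pow_pos hN0 2]
  have hdcod : ∀ y, d y ≤ cod E s y := fun y =>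
    sum_le_sum_of_subset_of_nonneg (subset_univ _) fun _ _ _ => hg0 _ _
  have hDup : D ≤ u * S.card + τ * N ^ 2 := by
    calc D ≤ ∑ y ∈ U, ((S.card : ℝ) + p y) := sum_le_sum fun y _ => (hdcod y).trans (hcod y)
      _ = u * S.card + ∑ y ∈ U, p y := by rw [sum_add_distrib, sum_const, nsmul_eq_mul]
      _ ≤ u * S.card + ∑ y, p y := by
        gcongr
        · exact fun y _ _ => hp0 y
        · exact subset_univ _
      _ ≤ _ := by gcongr
  have hu23 : u ≤ (2 / 3 + 12 * τ) * N := by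
    by_contra! hcon
    have hSc : (S.card : ℝ) = N - u := by linarith
    rw [hSc] at hDup
    have e3 : u * (N - u) < (2 / 3 + 12 * τ) * N * (N - (2 / 3 + 12 * τ) * N) := by
      have : 0 < (u - (2 / 3 + 12 * τ) * N) * (u + (2 / 3 + 12 * τ) * N - N) := by
        apply mul_pos
        · linarith
        · nlinarith
      nlinarith
    nlinarith [pow_pos hN0 2, mul_pos hτ (pow_pos hN0 2)]
  have hu0 : 0 < u := by
    rcases (Nat.cast_nonneg U.card : (0 : ℝ) ≤ U.card).lt_or_eq with h | h
    · exact h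
    · exfalso
      have hUe : U = ∅ := by
        rw [← card_eq_zero]; exact_mod_cast h.symm
      rw [hD, hUe, sum_empty] at hD9
      nlinarith [pow_pos hN0 2]
  set t : V → V → ℝ := fun y z => ∑ w, ind (E s y w ∧ E s z w) with ht
  set Q : ℝ := ∑ y ∈ U, d y ^ 2 with hQ
  have hCS : D ^ 2 ≤ u * Q := sq_sum_le_card_mul_sum_sq
  have hsum1 : ∑ y ∈ U, ∑ z ∈ U, g y z * (d y + d z) = 2 * Q := by
    have a1 : ∑ y ∈ U, ∑ z ∈ U, g y z * d y = Q := by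
      refine sum_congr rfl fun y _ => ?_
      rw [← sum_mul, sq]
    have a2 : ∑ y ∈ U, ∑ z ∈ U, g y z * d z = Q := by
      rw [sum_comm, ← a1]
      exact sum_congr rfl fun y _ => sum_congr rfl fun z _ => by rw [hgs]
    simp only [mul_add, sum_add_distrib]
    rw [a1, a2]; ring
  have hUsub : ∀ f : V → ℝ, (∀ y, 0 ≤ f y) → ∑ y ∈ U, f y ≤ ∑ y, f y := fun f hf =>
    sum_le_sum_of_subset_of_nonneg (subset_univ _) fun y _ _ => hf y
  have hsum2 : ∑ y ∈ U, ∑ z ∈ U, g y z * t y z ≤ τ * N ^ 3 := by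
    refine le_trans ?_ hT
    have ht0 : ∀ y z, 0 ≤ g y z * t y z := fun y z =>
      mul_nonneg (hg0 _ _) (sum_nonneg fun w _ => ind_nonneg _)
    calc _ ≤ ∑ y ∈ U, ∑ z, g y z * t y z := sum_le_sum fun y _ => hUsub _ (ht0 y)
      _ ≤ ∑ y, ∑ z, g y z * t y z := hUsub _ fun y => sum_nonneg fun z _ => ht0 y z
      _ = _ := by
        refine sum_congr rfl fun y _ => sum_congr rfl fun z _ => ?_
        rw [mul_sum]
        exact sum_congr rfl fun w _ => by rw [← ind_and]
  have hf0 := fiveAt_nonneg E s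
  have hsum3 : ∑ y ∈ U, ∑ z ∈ U, g y z * (fiveAt E s y + fiveAt E s z) ≤ 2 * τ * N ^ 5 := by
    have b1 : ∑ y ∈ U, fiveAt E s y ≤ τ * N ^ 4 := (hUsub _ hf0).trans hF
    have b2 : (0 : ℝ) ≤ S.card := by positivity
    have b3 : 0 ≤ ∑ y ∈ U, fiveAt E s y := sum_nonneg fun y _ => hf0 y
    calc _ ≤ ∑ y ∈ U, ∑ z ∈ U, (fiveAt E s y + fiveAt E s z) := by
          refine sum_le_sum fun y _ => sum_le_sum fun z _ => ?_
          exact mul_le_of_le_one_left (add_nonneg (hf0 y) (hf0 z)) (ind_le_one _)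
      _ = 2 * (u * ∑ y ∈ U, fiveAt E s y) := by
          simp only [sum_add_distrib, sum_const, nsmul_eq_mul, ← mul_sum]
          ring
      _ ≤ 2 * (N * (τ * N ^ 4)) := by gcongr; linarith
      _ = _ := by ring
  obtain ⟨y, hyU, z, hzU, hyz⟩ : ∃ y ∈ U, ∃ z ∈ U, (2 / 3 - 76 * τ) * N * g y z <
      g y z * (d y + d z) - 2 * (g y z * t y z) -
        2 / N ^ 2 * (g y z * (fiveAt E s y + fiveAt E s z)) := by
    have hlt : ∑ y ∈ U, ∑ z ∈ U, (2 / 3 - 76 * τ) * N * g y z < ∑ y ∈ U, ∑ z ∈ U,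
      (g y z * (d y + d z) - 2 * (g y z * t y z) -
        2 / N ^ 2 * (g y z * (fiveAt E s y + fiveAt E s z))) := by
      simp only [sum_sub_distrib, ← mul_sum]
      rw [hsum1]
      have c1 : 2 / N ^ 2 * ∑ y ∈ U, ∑ z ∈ U, g y z * (fiveAt E s y + fiveAt E s z)
          ≤ 4 * τ * N ^ 3 := by
        calc _ ≤ 2 / N ^ 2 * (2 * τ * N ^ 5) := by gcongr
          _ = _ := by field_simp; ring
      have c2 : (2 / 3 - 21 * τ) * N * u ≤ 2 * D := by
        rcases le_or_gt 0 (2 / 3 - 21 * τ) with h | h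
        · have : (2 / 3 - 21 * τ) * N * u ≤ (2 / 3 - 21 * τ) * N * ((2 / 3 + 12 * τ) * N) := by
            gcongr
          nlinarith [mul_pos hτ (pow_pos hN0 2), mul_pos (mul_pos hτ hτ) (pow_pos hN0 2)]
        · have : (2 / 3 - 21 * τ) * N * u ≤ 0 := by
            apply mul_nonpos_of_nonpos_of_nonneg _ hu0.le
            apply mul_nonpos_of_nonpos_of_nonneg h.le hN0.le
          nlinarith [pow_pos hN0 2]
      have c3 : (2 / 3 - 21 * τ) * N * D ≤ 2 * Q := by
        have : (2 / 3 - 21 * τ) * N * u * D ≤ 2 * D * D := by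
          apply mul_le_mul_of_nonneg_right c2; nlinarith [pow_pos hN0 2]
        have : u * ((2 / 3 - 21 * τ) * N * D) ≤ u * (2 * Q) := by nlinarith
        exact le_of_mul_le_mul_left this hu0
      have c4 : ∑ y ∈ U, ∑ z ∈ U, g y z = D := rfl
      rw [c4]
      have c5 : 55 * τ * N * (N ^ 2 / 9) ≤ 55 * τ * N * D := by gcongr
      nlinarith [mul_pos hτ (pow_pos hN0 3)]
    obtain ⟨y, hy, h⟩ := exists_lt_of_sum_lt hlt
    obtain ⟨z, hz, h⟩ := exists_lt_of_sum_lt h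
    exact ⟨y, hy, z, hz, h⟩
  have hEyz : E s y z := by
    by_contra h
    have : g y z = 0 := ind_of_not h
    rw [this] at hyz
    simp at hyz
  have hg1 : g y z = 1 := ind_of hEyz
  rw [hg1] at hyz
  have ht0 : 0 ≤ t y z := sum_nonneg fun w _ => ind_nonneg _
  have hdut : d y + d z ≤ u + t y z := by
    have : d y + d z ≤ ∑ w ∈ U, (1 + ind (E s y w ∧ E s z w)) := by
      simp only [hd, hg, ← sum_add_distrib]
      refine sum_le_sum fun w _ => ?_
      by_cases h1 : E s y w <;> by_cases h2 : E s z w <;> simp [ind, h1, h2]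
    rw [sum_add_distrib] at this
    have h2 : ∑ w ∈ U, ind (E s y w ∧ E s z w) ≤ t y z := hUsub _ fun w => ind_nonneg _
    have h3 : ∑ w ∈ U, (1 : ℝ) = u := by simp [hu]
    linarith
  have hfs : fiveAt E s y + fiveAt E s z ≤ 44 * τ * N ^ 3 := by
    have h1 : 2 / N ^ 2 * (fiveAt E s y + fiveAt E s z) ≤ 88 * τ * N := by linarith
    have h2 : N ^ 2 * (2 / N ^ 2 * (fiveAt E s y + fiveAt E s z)) ≤ N ^ 2 * (88 * τ * N) := by
      gcongr
    have h3 : N ^ 2 * (2 / N ^ 2 * (fiveAt E s y + fiveAt E s z))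
      = 2 * (fiveAt E s y + fiveAt E s z) := by field_simp
    nlinarith
  have hpen : 0 ≤ 2 / N ^ 2 * (fiveAt E s y + fiveAt E s z) :=
    mul_nonneg (by positivity) (add_nonneg (hf0 y) (hf0 z))
  have htt : t y z ≤ 88 * τ * N := by linarith
  set B := U.filter (E s y) with hB
  set C := U.filter (E s z) \ B with hC
  have hmono : ∀ (P Q : Finset V), P ⊆ Q → ∑ x ∈ P, ∑ y ∈ P, cod E x y
      ≤ ∑ x ∈ Q, ∑ y ∈ Q, cod E x y := by
    intro P Q hPQ
    calc _ ≤ ∑ x ∈ P, ∑ y ∈ Q, cod E x y := sum_le_sum fun x _ =>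
          sum_le_sum_of_subset_of_nonneg hPQ fun y _ _ => cod_nonneg E x y
      _ ≤ _ := sum_le_sum_of_subset_of_nonneg hPQ fun x _ _ =>
          sum_nonneg fun y _ => cod_nonneg E x y
  have hDB : d y = B.card := by
    simp only [hd, hg, hB, card_filter, ind]
    push_cast
    exact sum_congr rfl fun _ _ => by congr
  have hDC : d z = (U.filter (E s z)).card := by
    simp only [hd, hg, card_filter, ind]
    push_cast
    exact sum_congr rfl fun _ _ => by congr
  have hCc : d z ≤ C.card + t y z := by
    have h1 : (U.filter (E s z)).card ≤ C.card + (univ.filter fun w => E s y w ∧ E s z w).card := by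
      refine le_trans (card_le_card ?_) (card_union_le _ _)
      intro w hw
      simp only [hC, hB, mem_union, mem_sdiff, mem_filter, mem_univ, true_and] at hw ⊢
      tauto
    rw [hDC, ht]
    simp only [sum_ind_filter]
    exact_mod_cast h1
  have hSU : Disjoint S U := disjoint_sdiff
  obtain ⟨χ, hχ⟩ := exists_coloring_of_parts hE S B C
    (hSU.mono_right (filter_subset _ _))
    (hSU.mono_right (sdiff_subset.trans (filter_subset _ _))) disjoint_sdiff
    (180 * τ) (2 / 9 - τ)
    (hS.trans (by rw [← hN]; nlinarith [mul_pos hτ (pow_pos hN0 3)]))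
    (by
      refine (hmono B (univ.filter (E s y)) (filter_subset_filter _ (subset_univ _))).trans ?_
      rw [← fiveAt_eq, ← hN]
      nlinarith [mul_pos hτ (pow_pos hN0 3), hf0 z])
    (by
      refine (hmono C (univ.filter (E s z))
        (sdiff_subset.trans (filter_subset_filter _ (subset_univ _)))).trans ?_
      rw [← fiveAt_eq, ← hN]
      nlinarith [mul_pos hτ (pow_pos hN0 3), hf0 y])
    (by
      rw [← hN, ← hDB]
      nlinarith [mul_pos hτ hN0])
    (by
      calc (2 / 9 - τ) * (Fintype.card V : ℝ) ^ 3
          = ∑ x : V, (2 / 9 - τ) * (Fintype.card V : ℝ) ^ 2 := by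
            simp only [sum_const, card_univ, nsmul_eq_mul]; ring
        _ ≤ _ := sum_le_sum fun x _ => hdeg x)
  refine ⟨χ, le_trans ?_ hχ⟩
  rw [← hN]
  nlinarith [mul_pos hτ (pow_pos hN0 3)]

end Local

/-- Degree version of weak stability for `F_5^S(m)`. -/
theorem weak_stability {m : ℕ} (hm : 2 ≤ m) (ε : ℝ) (hε : 0 < ε) :
    ∃ δ : ℝ, 0 < δ ∧ ∃ n0 : ℕ, ∀ (V : Type) [Fintype V] (E : V → V → V → Prop), IsTriple E →
      CopFree E m univ → n0 ≤ Fintype.card V →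
      (∀ x, (2 / 9 - δ) * (Fintype.card V : ℝ) ^ 2 ≤ ∑ y, cod E x y) →
      ∃ χ : V → Fin 3, (1 / 27 - ε) * (Fintype.card V : ℝ) ^ 3 ≤ rainbow E χ 0 1 2 := by
  set τ : ℝ := min (1 / 27) (ε / 451) with hτ
  have hτ0 : 0 < τ := by positivity
  have hτε : 451 * τ ≤ ε := by
    have := min_le_right (1 / 27 : ℝ) (ε / 451); linarith
  obtain ⟨n1, h1⟩ := CopFree.few_five hm (τ ^ 2 / 729) (by positivity)
  obtain ⟨n2, h2⟩ := CopFree.few_four hm (τ ^ 2 / 729) (by positivity)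
  refine ⟨τ, hτ0, max 1 (max n1 n2), fun V _ E hE hfree hn hdeg => ?_⟩
  simp only [max_le_iff] at hn
  obtain ⟨χ, hχ⟩ := exists_coloring_of_few hE τ hτ0 (min_le_left _ _) (by omega) hdeg
    (h1 V E hE hfree hn.2.1) (h2 V E hE hfree hn.2.2)
  refine ⟨χ, le_trans ?_ hχ⟩
  gcongr

section Local
variable {V : Type} [Fintype V] {E : V → V → V → Prop} {χ : V → Fin 3}

/-- The number of vertices of colour `i`. -/
noncomputable def cls (χ : V → Fin 3) (i : Fin 3) : ℝ := ∑ x, ind (χ x = i)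

/-- The number of non-edges whose vertices receive the colours `i`, `j`, `k`, in this order. -/
noncomputable def miss (E : V → V → V → Prop) (χ : V → Fin 3) (i j k : Fin 3) : ℝ :=
  ∑ x, ∑ y, ∑ z, ind (χ x = i ∧ χ y = j ∧ χ z = k ∧ ¬ E x y z)

/-- The number of pairs in the link of `v` whose vertices receive the colours `i`, `j`. -/
noncomputable def lk (E : V → V → V → Prop) (χ : V → Fin 3) (v : V) (i j : Fin 3) : ℝ :=
  ∑ y, ∑ z, ind (χ y = i ∧ χ z = j ∧ E v y z)

lemma cls_nonneg (i : Fin 3) : 0 ≤ cls χ i := sum_nonneg fun _ _ => ind_nonneg _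

lemma lk_nonneg (v : V) (i j : Fin 3) : 0 ≤ lk E χ v i j :=
  sum_nonneg fun _ _ => sum_nonneg fun _ _ => ind_nonneg _

lemma cls_mul_cls (i j : Fin 3) : cls χ i * cls χ j = ∑ x, ∑ y, ind (χ x = i ∧ χ y = j) := by
  rw [cls, cls, sum_mul_sum]
  exact sum_congr rfl fun x _ => sum_congr rfl fun y _ => (ind_and _ _).symm

lemma rainbow_add_miss (i j k : Fin 3) :
    rainbow E χ i j k + miss E χ i j k = cls χ i * (cls χ j * cls χ k) := by
  rw [cls_mul_cls, cls, sum_mul]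
  simp only [rainbow, miss, mul_sum, ← sum_add_distrib]
  refine sum_congr rfl fun x _ => ?_
  refine sum_congr rfl fun y _ => sum_congr rfl fun z _ => ?_
  simp only [ind_and]
  by_cases h : E x y z
  · rw [ind_of h, ind_of_not (not_not_intro h)]; ring
  · rw [ind_of_not h, ind_of h]; ring

lemma sum_cls : cls χ 0 + cls χ 1 + cls χ 2 = Fintype.card V := by
  simp only [cls, ← sum_add_distrib]
  have : ∀ x, ind (χ x = 0) + ind (χ x = 1) + ind (χ x = 2) = (1 : ℝ) := by
    intro x
    generalize χ x = a
    fin_cases a <;> simp [ind]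
  simp [this]

lemma sum_lk (v : V) : ∑ i, ∑ j, lk E χ v i j = ∑ y, cod E v y := by
  have : ∀ y z, ∑ i, ∑ j, ind (χ y = i ∧ χ z = j ∧ E v y z) = ind (E v y z) := by
    intro y z
    simp only [ind_and, ← mul_sum, ← sum_mul]
    have h : ∀ a : Fin 3, ∑ i, ind (a = i) = 1 := by
      intro a
      fin_cases a <;> simp [Fin.sum_univ_three, ind]
    rw [h, h]; ring
  simp only [lk, cod]
  simp only [Fin.sum_univ_three, ← sum_add_distrib] at this ⊢
  exact sum_congr rfl fun y _ => sum_congr rfl fun z _ => this y z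

lemma lk_comm (hE : IsTriple E) (v : V) (i j : Fin 3) : lk E χ v i j = lk E χ v j i := by
  unfold lk
  rw [sum_comm]
  refine sum_congr rfl fun y _ => sum_congr rfl fun z _ => ind_congr ?_
  have := @hE.swap23 v y z
  have := @hE.swap23 v z y
  tauto

lemma rainbow_perm (hE : IsTriple E) {i j k : Fin 3} (hij : i ≠ j) (hik : i ≠ k) (hjk : j ≠ k) :
    rainbow E χ i j k = rainbow E χ 0 1 2 := by
  have h021 := rainbow_swap23 hE χ 0 2 1
  have h102 := rainbow_swap12 hE χ 1 0 2
  have h120 := rainbow_swap23 hE χ 1 2 0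
  have h201 := rainbow_swap12 hE χ 2 0 1
  have h210 := rainbow_swap12 hE χ 2 1 0
  revert hij hik hjk
  fin_cases i <;> fin_cases j <;> fin_cases k <;> simp <;> linarith

lemma sum_cls_perm {i j k : Fin 3} (hij : i ≠ j) (hik : i ≠ k) (hjk : j ≠ k) :
    cls χ i + cls χ j + cls χ k = Fintype.card V := by
  have := sum_cls (χ := χ)
  revert hij hik hjk
  fin_cases i <;> fin_cases j <;> fin_cases k <;> simp <;> linarith

lemma miss_le (hE : IsTriple E) {ε : ℝ}
    (hχ : (1 / 27 - ε) * (Fintype.card V : ℝ) ^ 3 ≤ rainbow E χ 0 1 2)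
    {i j k : Fin 3} (hij : i ≠ j) (hik : i ≠ k) (hjk : j ≠ k) :
    miss E χ i j k ≤ ε * (Fintype.card V : ℝ) ^ 3 := by
  have h1 := rainbow_add_miss (E := E) (χ := χ) i j k
  rw [rainbow_perm hE hij hik hjk] at h1
  have h2 := sum_cls_perm (χ := χ) hij hik hjk
  have a0 := cls_nonneg (χ := χ) i
  have b0 := cls_nonneg (χ := χ) j
  have c0 := cls_nonneg (χ := χ) k
  have amgm : cls χ i * (cls χ j * cls χ k) ≤ 1 / 27 * (Fintype.card V : ℝ) ^ 3 := by
    rw [← h2]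
    generalize cls χ i = a at *
    generalize cls χ j = b at *
    generalize cls χ k = c at *
    nlinarith [mul_nonneg a0 (sq_nonneg (b - c)), mul_nonneg b0 (sq_nonneg (a - c)),
      mul_nonneg c0 (sq_nonneg (a - b)), mul_nonneg (add_nonneg (add_nonneg a0 b0) c0)
      (add_nonneg (add_nonneg (sq_nonneg (a - b)) (sq_nonneg (a - c))) (sq_nonneg (b - c)))]
  linarith

lemma cls_mul_ge (hE : IsTriple E) {ε : ℝ}
    (hχ : (1 / 27 - ε) * (Fintype.card V : ℝ) ^ 3 ≤ rainbow E χ 0 1 2)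
    {i j k : Fin 3} (hij : i ≠ j) (hik : i ≠ k) (hjk : j ≠ k) :
    (1 / 27 - ε) * (Fintype.card V : ℝ) ^ 3 ≤ cls χ i * (cls χ j * cls χ k) := by
  have h1 := rainbow_add_miss (E := E) (χ := χ) i j k
  rw [rainbow_perm hE hij hik hjk] at h1
  have : 0 ≤ miss E χ i j k :=
    sum_nonneg fun _ _ => sum_nonneg fun _ _ => sum_nonneg fun _ _ => ind_nonneg _
  linarith

end Local

/-- Few pairs of any link lie inside one colour class. -/
lemma exists_lk_diag_le {m : ℕ} (hm : 2 ≤ m) :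
    ∃ n0 : ℕ, ∀ (V : Type) [Fintype V] (E : V → V → V → Prop), IsTriple E →
      CopFree E m univ → n0 ≤ Fintype.card V → ∀ χ : V → Fin 3,
      (1 / 27 - 1 / 2000000) * (Fintype.card V : ℝ) ^ 3 ≤ rainbow E χ 0 1 2 →
      ∀ (v : V) (i j k : Fin 3), i ≠ j → i ≠ k → j ≠ k →
        lk E χ v i i ≤ 1 / 1000 * (Fintype.card V : ℝ) ^ 2 := by
  obtain ⟨n0, H⟩ := exists_box4 (1 / 2000000) (by norm_num) (m + 1) (by omega)
  refine ⟨max 1 n0, fun V _ E hE hfree hn χ hχ v i j k hij hik hjk => ?_⟩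
  simp only [max_le_iff] at hn
  by_contra! hcon
  have hmiss := miss_le hE hχ hij hik hjk
  have hcls := cls_mul_ge hE hχ hij hik hjk
  have hsum := sum_cls_perm (χ := χ) hij hik hjk
  obtain ⟨A, A', B, C, hA, hA', hB, hC, h⟩ := H V
    (fun a a' b c => E v a a' ∧ E a b c ∧ E a' b c) hn.2 (by
    have key : lk E χ v i i * (cls χ j * cls χ k) ≤
        ∑ a, ∑ a', ∑ b, ∑ c, ind (E v a a' ∧ E a b c ∧ E a' b c) +
        ∑ a, ∑ _a' : V, ∑ b, ∑ c, ind (χ a = i ∧ χ b = j ∧ χ c = k ∧ ¬ E a b c) +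
        ∑ _a : V, ∑ a', ∑ b, ∑ c, ind (χ a' = i ∧ χ b = j ∧ χ c = k ∧ ¬ E a' b c) := by
      rw [cls_mul_cls]
      simp only [lk, sum_mul, ← sum_add_distrib]
      refine sum_le_sum fun a _ => sum_le_sum fun a' _ => ?_
      rw [mul_sum]
      refine sum_le_sum fun b _ => ?_
      rw [mul_sum]
      refine sum_le_sum fun c _ => ?_
      rw [← ind_and]
      by_cases hh : (χ a = i ∧ χ a' = i ∧ E v a a') ∧ χ b = j ∧ χ c = k
      · obtain ⟨⟨h1, h2, h3⟩, h4, h5⟩ := hh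
        by_cases h6 : E a b c <;> by_cases h7 : E a' b c <;>
          simp [ind, h1, h2, h3, h4, h5, h6, h7]
      · rw [ind_of_not hh]
        exact add_nonneg (add_nonneg (ind_nonneg _) (ind_nonneg _)) (ind_nonneg _)
    have e1 : ∑ a, ∑ _a' : V, ∑ b, ∑ c, ind (χ a = i ∧ χ b = j ∧ χ c = k ∧ ¬ E a b c)
        = Fintype.card V * miss E χ i j k := by
      rw [sum_comm]
      simp only [sum_const, card_univ, nsmul_eq_mul, miss]
    have e2 : ∑ _a : V, ∑ a', ∑ b, ∑ c, ind (χ a' = i ∧ χ b = j ∧ χ c = k ∧ ¬ E a' b c)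
        = Fintype.card V * miss E χ i j k := by
      simp only [sum_const, card_univ, nsmul_eq_mul, miss]
    rw [e1, e2] at key
    have hN1 : (1 : ℝ) ≤ Fintype.card V := by exact_mod_cast hn.1
    have a0 := cls_nonneg (χ := χ) i
    have b0 := cls_nonneg (χ := χ) j
    have c0 := cls_nonneg (χ := χ) k
    generalize (Fintype.card V : ℝ) = N at *
    have hjk : (1 / 27 - 1 / 2000000) * N ^ 2 ≤ cls χ j * cls χ k := by
      have h1 : cls χ i * (cls χ j * cls χ k) ≤ N * (cls χ j * cls χ k) := by
        gcongr
        linarith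
      have : N * ((1 / 27 - 1 / 2000000) * N ^ 2) ≤ N * (cls χ j * cls χ k) := by nlinarith
      exact le_of_mul_le_mul_left this (by linarith)
    have h2 : (1 / 1000 * N ^ 2) * ((1 / 27 - 1 / 2000000) * N ^ 2)
      ≤ lk E χ v i i * (cls χ j * cls χ k) := by
      gcongr
      exact lk_nonneg _ _ _
    have h3 : N * miss E χ i j k ≤ N * (1 / 2000000 * N ^ 3) := by gcongr
    nlinarith [pow_pos (by linarith : 0 < N) 4])
  obtain ⟨a, ha⟩ := card_pos.1 (by omega : 0 < A.card)
  obtain ⟨a', ha'⟩ := card_pos.1 (by omega : 0 < A'.card)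
  obtain ⟨b, hb⟩ := card_pos.1 (by omega : 0 < B.card)
  obtain ⟨c, hc⟩ := card_pos.1 (by omega : 0 < C.card)
  classical
  refine not_copFree hE hm (A := A ∪ A') (B := B) (C := C) (X := univ) ?_ hB.ge hC.ge
    (subset_univ _) (subset_univ _) (subset_univ _) ?_ (mem_union_left _ ha)
    (mem_union_right _ ha') (mem_univ v) (hE.rot (h a ha a' ha' b hb c hc).1) hfree
  · exact hA.ge.trans (card_le_card subset_union_left)
  · intro x hx y hy z hz
    rcases mem_union.1 hx with hx | hx
    · exact (h x hx a' ha' y hy z hz).2.1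
    · exact (h a ha x hx y hy z hz).2.2

/-- At most one pair of colour classes spans many pairs of a link. -/
lemma exists_lk_cross_le {m : ℕ} (hm : 2 ≤ m) :
    ∃ n0 : ℕ, ∀ (V : Type) [Fintype V] (E : V → V → V → Prop), IsTriple E →
      CopFree E m univ → n0 ≤ Fintype.card V → ∀ χ : V → Fin 3,
      (1 / 27 - 1 / 2000000) * (Fintype.card V : ℝ) ^ 3 ≤ rainbow E χ 0 1 2 →
      ∀ (v : V) (i j k : Fin 3), i ≠ j → i ≠ k → j ≠ k →
        1 / 1000 * (Fintype.card V : ℝ) ^ 2 < lk E χ v j k →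
        lk E χ v i k ≤ 1 / 1000 * (Fintype.card V : ℝ) ^ 2 := by
  obtain ⟨n0, H⟩ := exists_box4 (1 / 2000000) (by norm_num) (m + 1) (by omega)
  refine ⟨max 1 n0, fun V _ E hE hfree hn χ hχ v i j k hij hik hjk hcon1 => ?_⟩
  simp only [max_le_iff] at hn
  by_contra! hcon
  have hmiss := miss_le hE hχ hij hik hjk
  obtain ⟨B, C, A, W, hB, hC, hA, hW, h⟩ := H V
    (fun b c a w => E v b c ∧ E v a w ∧ E a b c) hn.2 (by
    have key : lk E χ v j k * lk E χ v i k ≤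
        ∑ b, ∑ c, ∑ a, ∑ w, ind (E v b c ∧ E v a w ∧ E a b c) +
        ∑ b, ∑ c, ∑ a, ∑ _w : V, ind (χ a = i ∧ χ b = j ∧ χ c = k ∧ ¬ E a b c) := by
      simp only [lk, sum_mul, ← sum_add_distrib]
      refine sum_le_sum fun b _ => sum_le_sum fun c _ => ?_
      rw [mul_sum]
      refine sum_le_sum fun a _ => ?_
      rw [mul_sum]
      refine sum_le_sum fun w _ => ?_
      rw [← ind_and]
      by_cases hh : (χ b = j ∧ χ c = k ∧ E v b c) ∧ χ a = i ∧ χ w = k ∧ E v a w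
      · rw [ind_of hh]
        by_cases h7 : E a b c
        · rw [ind_of (p := E v b c ∧ E v a w ∧ E a b c) ⟨hh.1.2.2, hh.2.2.2, h7⟩]
          exact le_add_of_nonneg_right (ind_nonneg _)
        · rw [ind_of (p := χ a = i ∧ χ b = j ∧ χ c = k ∧ ¬ E a b c)
            ⟨hh.2.1, hh.1.1, hh.1.2.1, h7⟩]
          exact le_add_of_nonneg_left (ind_nonneg _)
      · rw [ind_of_not hh]
        exact add_nonneg (ind_nonneg _) (ind_nonneg _)
    have e1 : ∑ b, ∑ c, ∑ a, ∑ _w : V, ind (χ a = i ∧ χ b = j ∧ χ c = k ∧ ¬ E a b c)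
        = Fintype.card V * miss E χ i j k := by
      simp only [sum_const, card_univ, nsmul_eq_mul, ← mul_sum]
      congr 1
      unfold miss
      calc _ = ∑ b, ∑ a, ∑ c, ind (χ a = i ∧ χ b = j ∧ χ c = k ∧ ¬ E a b c) :=
            sum_congr rfl fun b _ => sum_comm
        _ = _ := sum_comm
    rw [e1] at key
    have hN1 : (1 : ℝ) ≤ Fintype.card V := by exact_mod_cast hn.1
    generalize (Fintype.card V : ℝ) = N at *
    have h2 : (1 / 1000 * N ^ 2) * (1 / 1000 * N ^ 2) ≤ lk E χ v j k * lk E χ v i k := by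
      gcongr
      exact lk_nonneg _ _ _
    have h3 : N * miss E χ i j k ≤ N * (1 / 2000000 * N ^ 3) := by gcongr
    nlinarith [pow_pos (by linarith : 0 < N) 4])
  obtain ⟨a, ha⟩ := card_pos.1 (by omega : 0 < A.card)
  obtain ⟨w, hw⟩ := card_pos.1 (by omega : 0 < W.card)
  obtain ⟨b, hb⟩ := card_pos.1 (by omega : 0 < B.card)
  obtain ⟨c, hc⟩ := card_pos.1 (by omega : 0 < C.card)
  classical
  refine not_copFree hE hm (A := insert v A) (B := B) (C := C) (X := univ) ?_ hB.ge hC.ge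
    (subset_univ _) (subset_univ _) (subset_univ _) ?_ (mem_insert_self _ _)
    (mem_insert_of_mem ha) (mem_univ w) (h b hb c hc a ha w hw).2.1 hfree
  · exact hA.ge.trans (card_le_card (subset_insert _ _))
  · intro x hx y hy z hz
    rcases mem_insert.1 hx with rfl | hx
    · exact (h y hy z hz a ha w hw).1
    · exact (h y hy z hz x hx w hw).2.2

/-- No edge contains two vertices whose links both span many pairs of the same two classes. -/
lemma exists_not_edge {m : ℕ} (hm : 2 ≤ m) :
    ∃ n0 : ℕ, ∀ (V : Type) [Fintype V] (E : V → V → V → Prop), IsTriple E →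
      CopFree E m univ → n0 ≤ Fintype.card V → ∀ χ : V → Fin 3,
      (1 / 27 - 1 / 2000000) * (Fintype.card V : ℝ) ^ 3 ≤ rainbow E χ 0 1 2 →
      ∀ (v v' w : V) (i j k : Fin 3), i ≠ j → i ≠ k → j ≠ k →
        (1 / 9 - 1 / 200) * (Fintype.card V : ℝ) ^ 2 ≤ lk E χ v j k →
        (1 / 9 - 1 / 200) * (Fintype.card V : ℝ) ^ 2 ≤ lk E χ v' j k → ¬ E v v' w := by
  obtain ⟨n0, H⟩ := exists_box3 (1 / 1000) (by norm_num) (m + 1) (by omega)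
  refine ⟨max 1 n0, fun V _ E hE hfree hn χ hχ v v' w i j k hij hik hjk hv hv' hedge => ?_⟩
  simp only [max_le_iff] at hn
  have hmiss := miss_le hE hχ hij hik hjk
  have hcls := cls_mul_ge hE hχ hij hik hjk
  have hsum := sum_cls_perm (χ := χ) hij hik hjk
  obtain ⟨A, B, C, hA, hB, hC, h⟩ := H V
    (fun a b c => E a b c ∧ E v b c ∧ E v' b c) hn.2 (by
    have key : cls χ i * (lk E χ v j k + lk E χ v' j k - cls χ j * cls χ k) ≤
        ∑ a, ∑ b, ∑ c, ind (E a b c ∧ E v b c ∧ E v' b c) + miss E χ i j k := by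
      rw [cls_mul_cls, cls, sum_mul]
      simp only [miss, lk, ← sum_add_distrib, ← sum_sub_distrib]
      refine sum_le_sum fun a _ => ?_
      rw [mul_sum]
      refine sum_le_sum fun b _ => ?_
      rw [mul_sum]
      refine sum_le_sum fun c _ => ?_
      by_cases h1 : χ a = i <;> by_cases h2 : χ b = j <;> by_cases h3 : χ c = k <;>
        by_cases h4 : E a b c <;> by_cases h5 : E v b c <;> by_cases h6 : E v' b c <;>
        simp [ind, h1, h2, h3, h4, h5, h6]
    have hN1 : (1 : ℝ) ≤ Fintype.card V := by exact_mod_cast hn.1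
    have a0 := cls_nonneg (χ := χ) i
    have b0 := cls_nonneg (χ := χ) j
    have c0 := cls_nonneg (χ := χ) k
    generalize (Fintype.card V : ℝ) = N at *
    generalize cls χ i = a at *
    generalize cls χ j = b at *
    generalize cls χ k = c at *
    have hN0 : 0 < N := by linarith
    have hbc : b * c ≤ (N - a) ^ 2 / 4 := by
      rw [← hsum]; nlinarith [sq_nonneg (b - c)]
    have hbc4 : b * c ≤ N ^ 2 / 4 := by nlinarith
    have ha9 : N / 9 ≤ a := by
      by_contra! hc9
      have : a * (b * c) ≤ N / 9 * (N ^ 2 / 4) := by gcongr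
      nlinarith [pow_pos hN0 3]
    have hbc5 : b * c ≤ 1 / 5 * N ^ 2 := by nlinarith
    have h1 : N / 9 * (1 / 85 * N ^ 2) ≤ a * (lk E χ v j k + lk E χ v' j k - b * c) := by
      gcongr
      linarith
    nlinarith [pow_pos hN0 3])
  obtain ⟨a, ha⟩ := card_pos.1 (by omega : 0 < A.card)
  classical
  refine not_copFree hE hm (A := insert v (insert v' A)) (B := B) (C := C) (X := univ) ?_
    hB.ge hC.ge (subset_univ _) (subset_univ _) (subset_univ _) ?_ (mem_insert_self _ _)
    (mem_insert_of_mem (mem_insert_self _ _)) (mem_univ w) hedge hfree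
  · exact hA.ge.trans (card_le_card ((subset_insert _ _).trans (subset_insert _ _)))
  · intro x hx y hy z hz
    simp only [mem_insert] at hx
    rcases hx with rfl | rfl | hx
    · exact (h a ha y hy z hz).2.1
    · exact (h a ha y hy z hz).2.2
    · exact (h x hx y hy z hz).1

/-- Large `F_5^S(m)`-free 3-graphs of almost maximum minimum degree are 3-partite. -/
theorem degree_stability {m : ℕ} (hm : 2 ≤ m) :
    ∃ δ : ℝ, 0 < δ ∧ ∃ n0 : ℕ, ∀ (V : Type) [Fintype V] (E : V → V → V → Prop), IsTriple E →
      CopFree E m univ → n0 ≤ Fintype.card V →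
      (∀ x, (2 / 9 - δ) * (Fintype.card V : ℝ) ^ 2 ≤ ∑ y, cod E x y) →
      ∃ χ : V → Fin 3, ∀ x y z, E x y z → χ x ≠ χ y := by
  obtain ⟨δ, hδ, n1, H1⟩ := weak_stability hm (1 / 2000000) (by norm_num)
  obtain ⟨n2, H2⟩ := exists_lk_diag_le hm
  obtain ⟨n3, H3⟩ := exists_lk_cross_le hm
  obtain ⟨n4, H4⟩ := exists_not_edge hm
  refine ⟨min δ (1 / 1000), by positivity, max (max n1 n2) (max n3 n4),
    fun V _ E hE hfree hn hdeg => ?_⟩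
  simp only [max_le_iff] at hn
  obtain ⟨χ, hχ⟩ := H1 V E hE hfree hn.1.1 (fun x => le_trans (by gcongr; exact min_le_left _ _)
    (hdeg x))
  have hχ' : ∀ v, ∃ i, ∀ j k, i ≠ j → i ≠ k → j ≠ k →
      (1 / 9 - 1 / 200) * (Fintype.card V : ℝ) ^ 2 ≤ lk E χ v j k := by
    intro v
    have d := H2 V E hE hfree hn.1.2 χ hχ v
    have d0 := d 0 1 2 (by decide) (by decide) (by decide)
    have d1 := d 1 0 2 (by decide) (by decide) (by decide)
    have d2 := d 2 1 0 (by decide) (by decide) (by decide)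
    have c := H3 V E hE hfree hn.2.1 χ hχ v
    have hs := sum_lk (E := E) (χ := χ) v
    have h1 := hdeg v
    have h2 : (2 / 9 - 1 / 1000) * (Fintype.card V : ℝ) ^ 2
      ≤ (2 / 9 - min δ (1 / 1000)) * (Fintype.card V : ℝ) ^ 2 := by
      gcongr; exact min_le_right _ _
    simp only [Fin.sum_univ_three] at hs
    have s10 := lk_comm (χ := χ) hE v 1 0
    have s20 := lk_comm (χ := χ) hE v 2 0
    have s21 := lk_comm (χ := χ) hE v 2 1
    have hN := sq_nonneg (Fintype.card V : ℝ)
    by_cases h01 : 1 / 1000 * (Fintype.card V : ℝ) ^ 2 < lk E χ v 0 1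
    · have e1 := c 2 0 1 (by decide) (by decide) (by decide) h01
      have e2 := c 2 1 0 (by decide) (by decide) (by decide) (by rwa [s10])
      refine ⟨2, fun j k hj hk hjk => ?_⟩
      revert hj hk hjk
      fin_cases j <;> fin_cases k <;> simp <;> linarith
    by_cases h02 : 1 / 1000 * (Fintype.card V : ℝ) ^ 2 < lk E χ v 0 2
    · have e1 := c 1 0 2 (by decide) (by decide) (by decide) h02
      refine ⟨1, fun j k hj hk hjk => ?_⟩
      revert hj hk hjk
      fin_cases j <;> fin_cases k <;> simp <;> linarith
    · refine ⟨0, fun j k hj hk hjk => ?_⟩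
      revert hj hk hjk
      fin_cases j <;> fin_cases k <;> simp <;> linarith
  choose χ' hχ' using hχ'
  refine ⟨χ', fun x y z hxyz heq => ?_⟩
  have hne : ∀ i : Fin 3, ∃ j k, i ≠ j ∧ i ≠ k ∧ j ≠ k := by decide
  obtain ⟨j, k, hj, hk, hjk⟩ := hne (χ' x)
  exact H4 V E hE hfree hn.2.2 χ hχ x y z (χ' x) j k hj hk hjk (hχ' x j k hj hk hjk)
    (hχ' y j k (heq ▸ hj) (heq ▸ hk) hjk) hxyz

section Sets
variable {V : Type} (E : V → V → V → Prop)

/-- Twice the degree of `v` in the 3-graph induced on `X`. -/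
noncomputable def dg (X : Finset V) (v : V) : ℝ := ∑ y ∈ X, ∑ z ∈ X, ind (E v y z)

/-- Six times the number of edges induced on `X`. -/
noncomputable def tot (X : Finset V) : ℝ := ∑ x ∈ X, dg E X x

variable {E}

lemma dg_mono {X Y : Finset V} (h : X ⊆ Y) (v : V) : dg E X v ≤ dg E Y v := by
  calc _ ≤ ∑ y ∈ X, ∑ z ∈ Y, ind (E v y z) := sum_le_sum fun _ _ =>
        sum_le_sum_of_subset_of_nonneg h fun _ _ _ => ind_nonneg _
    _ ≤ _ := sum_le_sum_of_subset_of_nonneg h fun _ _ _ => sum_nonneg fun _ _ => ind_nonneg _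

lemma dg_le_sq (X : Finset V) (v : V) : dg E X v ≤ (X.card : ℝ) ^ 2 := by
  calc _ ≤ ∑ y ∈ X, ∑ z ∈ X, (1 : ℝ) := sum_le_sum fun _ _ => sum_le_sum fun _ _ => ind_le_one _
    _ = _ := by simp [sq]

lemma tot_le_cube (X : Finset V) : tot E X ≤ (X.card : ℝ) ^ 3 := by
  calc _ ≤ ∑ x ∈ X, (X.card : ℝ) ^ 2 := sum_le_sum fun _ _ => dg_le_sq _ _
    _ = _ := by rw [sum_const, nsmul_eq_mul]; ring

lemma dg_le_add [DecidableEq V] {X Z : Finset V} (h : Z ⊆ X) (v : V) :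
    dg E X v ≤ dg E Z v + 2 * X.card * (X \ Z).card := by
  have hc : (Z.card : ℝ) ≤ X.card := by exact_mod_cast card_le_card h
  have h1 : dg E X v = ∑ y ∈ X \ Z, ∑ z ∈ X, ind (E v y z) + ∑ y ∈ Z, ∑ z ∈ X, ind (E v y z) :=
    (sum_sdiff h).symm
  have h2 : ∑ y ∈ Z, ∑ z ∈ X, ind (E v y z) =
      ∑ y ∈ Z, ∑ z ∈ X \ Z, ind (E v y z) + dg E Z v := by
    rw [dg, ← sum_add_distrib]
    exact sum_congr rfl fun y _ => (sum_sdiff h).symm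
  have h3 : ∑ y ∈ X \ Z, ∑ z ∈ X, ind (E v y z) ≤ (X \ Z).card * X.card := by
    calc _ ≤ ∑ y ∈ X \ Z, ∑ z ∈ X, (1 : ℝ) :=
          sum_le_sum fun _ _ => sum_le_sum fun _ _ => ind_le_one _
      _ = _ := by simp
  have h4 : ∑ y ∈ Z, ∑ z ∈ X \ Z, ind (E v y z) ≤ X.card * (X \ Z).card := by
    calc _ ≤ ∑ y ∈ Z, ∑ z ∈ X \ Z, (1 : ℝ) :=
          sum_le_sum fun _ _ => sum_le_sum fun _ _ => ind_le_one _
      _ = Z.card * (X \ Z).card := by simp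
      _ ≤ _ := by gcongr
  linarith

lemma tot_le_erase [DecidableEq V] (hE : IsTriple E) {X : Finset V} {v : V} (hv : v ∈ X) :
    tot E X ≤ tot E (X.erase v) + 3 * dg E X v := by
  set Y := X.erase v with hY
  have hvY : v ∉ Y := notMem_erase v X
  have hXY : X = insert v Y := (insert_erase hv).symm
  have hYX : Y ⊆ X := erase_subset _ _
  have h1 : tot E X = dg E X v + ∑ x ∈ Y, dg E X x := by
    conv_lhs => rw [tot, hXY, sum_insert hvY, ← hXY]
  have h2 : ∀ x, dg E X x = ∑ z ∈ X, ind (E x v z) + ∑ y ∈ Y, ind (E x y v) + dg E Y x := by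
    intro x
    have e1 : dg E X x = ∑ z ∈ X, ind (E x v z) + ∑ y ∈ Y, ∑ z ∈ X, ind (E x y z) := by
      conv_lhs => rw [dg, hXY, sum_insert hvY, ← hXY]
    have e2 : ∀ y, ∑ z ∈ X, ind (E x y z) = ind (E x y v) + ∑ z ∈ Y, ind (E x y z) := by
      intro y
      conv_lhs => rw [hXY, sum_insert hvY]
    rw [e1, sum_congr rfl fun y _ => e2 y, sum_add_distrib, dg]; ring
  have h3 : ∑ x ∈ Y, ∑ z ∈ X, ind (E x v z) ≤ dg E X v := by
    rw [sum_congr rfl fun x _ => sum_congr rfl fun z _ => ind_congr ⟨hE.swap12, hE.swap12⟩]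
    exact sum_le_sum_of_subset_of_nonneg hYX fun _ _ _ => sum_nonneg fun _ _ => ind_nonneg _
  have h4 : ∑ x ∈ Y, ∑ y ∈ Y, ind (E x y v) ≤ dg E X v := by
    rw [sum_congr rfl fun x _ => sum_congr rfl fun z _ =>
      ind_congr (q := E v x z) ⟨fun h => hE.rot (hE.rot h), fun h => hE.rot h⟩]
    exact dg_mono hYX v
  rw [h1, sum_congr rfl fun x _ => h2 x, sum_add_distrib, sum_add_distrib]
  change _ ≤ ∑ x ∈ Y, dg E Y x + _
  linarith

lemma tot_le_sdiff [DecidableEq V] (hE : IsTriple E) (X : Finset V) {S : Finset V} (hS : S ⊆ X) :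
    tot E X ≤ tot E (X \ S) + 3 * ∑ v ∈ S, dg E X v := by
  induction S using Finset.induction_on with
  | empty => simp
  | insert v S hvS ih =>
    have hv : v ∈ X \ S := mem_sdiff.2 ⟨hS (mem_insert_self _ _), hvS⟩
    have h1 := ih ((subset_insert _ _).trans hS)
    have h2 := tot_le_erase hE hv
    have h3 := dg_mono (E := E) (sdiff_subset : X \ S ⊆ X) v
    rw [sum_insert hvS, sdiff_insert]
    linarith

/-- Every vertex set has a subset of large minimum degree that is at least as dense. -/
lemma exists_core (hE : IsTriple E) (κ : ℝ) (hκ : 0 ≤ κ) (Y : Finset V) :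
    ∃ Z ⊆ Y, tot E Y - κ * (Y.card : ℝ) ^ 3 ≤ tot E Z - κ * (Z.card : ℝ) ^ 3 ∧
      ∀ v ∈ Z, κ * ((Z.card : ℝ) ^ 2 - Z.card) ≤ dg E Z v := by
  classical
  obtain ⟨Z, hZ, hmax⟩ := exists_max_image Y.powerset
    (fun Z => tot E Z - κ * (Z.card : ℝ) ^ 3) ⟨Y, by simp⟩
  refine ⟨Z, mem_powerset.1 hZ, hmax Y (by simp), fun v hv => ?_⟩
  have h1 := hmax (Z.erase v) (mem_powerset.2 ((erase_subset _ _).trans (mem_powerset.1 hZ)))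
  have h2 := tot_le_erase hE hv
  have h3 : (Z.card : ℝ) = (Z.erase v).card + 1 := by exact_mod_cast (card_erase_add_one hv).symm
  simp only [h3] at h1 ⊢
  have : κ * (((Z.erase v).card : ℝ) + 1) ^ 3 - κ * ((Z.erase v).card : ℝ) ^ 3
    = 3 * (κ * ((((Z.erase v).card : ℝ) + 1) ^ 2 - (((Z.erase v).card : ℝ) + 1))) + κ := by ring
  linarith

/-- The number of vertices of `X` of colour `i`. -/
noncomputable def cl (X : Finset V) (χ : V → Fin 3) (i : Fin 3) : ℝ :=
  ((X.filter fun x => χ x = i).card : ℝ)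

lemma cl_nonneg (X : Finset V) (χ : V → Fin 3) (i : Fin 3) : 0 ≤ cl X χ i := Nat.cast_nonneg _

lemma cl_eq_sum (X : Finset V) (χ : V → Fin 3) (i : Fin 3) :
    cl X χ i = ∑ x ∈ X, ind (χ x = i) := by
  rw [cl, card_filter]
  push_cast
  exact sum_congr rfl fun x _ => by unfold ind; congr

lemma sum_cl_nat (X : Finset V) (χ : V → Fin 3) :
    (X.filter fun x => χ x = 0).card + (X.filter fun x => χ x = 1).card +
      (X.filter fun x => χ x = 2).card = X.card := by
  have h := card_eq_sum_card_fiberwise (s := X) (f := χ) (t := univ) (by simp)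
  rw [Fin.sum_univ_three] at h
  exact h.symm

lemma dg_le_of_proper {X : Finset V} {χ : V → Fin 3} (hE : IsTriple E)
    (hχ : ∀ x ∈ X, ∀ y ∈ X, ∀ z ∈ X, E x y z → χ x ≠ χ y) {v : V} (hv : v ∈ X) {i j k : Fin 3}
    (hij : i ≠ j) (hik : i ≠ k) (hjk : j ≠ k) (hi : χ v = i) :
    dg E X v ≤ 2 * (cl X χ j * cl X χ k) := by
  have h2 : ∀ j k, cl X χ j * cl X χ k = ∑ y ∈ X, ∑ z ∈ X, ind (χ y = j) * ind (χ z = k) := by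
    intro j k
    rw [cl_eq_sum, cl_eq_sum, sum_mul_sum]
  have : dg E X v ≤ cl X χ j * cl X χ k + cl X χ k * cl X χ j := by
    rw [h2, h2, dg]
    simp only [← sum_add_distrib]
    refine sum_le_sum fun y hy => sum_le_sum fun z hz => ?_
    by_cases h : E v y z
    · have a1 := hχ v hv y hy z hz h
      have a2 := hχ v hv z hz y hy (hE.swap23 h)
      have a3 := hχ y hy z hz v hv (hE.rot h)
      rw [hi] at a1 a2
      have : (χ y = j ∧ χ z = k) ∨ (χ y = k ∧ χ z = j) := by
        generalize χ y = b at *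
        generalize χ z = c at *
        clear hi h2
        revert i j k b c
        decide
      rw [ind_of h]
      rcases this with ⟨h5, h6⟩ | ⟨h5, h6⟩
      · rw [ind_of h5, ind_of h6, one_mul]
        exact le_add_of_nonneg_right (mul_nonneg (ind_nonneg _) (ind_nonneg _))
      · rw [ind_of h5, ind_of h6, one_mul]
        exact le_add_of_nonneg_left (mul_nonneg (ind_nonneg _) (ind_nonneg _))
    · rw [ind_of_not h]
      exact add_nonneg (mul_nonneg (ind_nonneg _) (ind_nonneg _))
        (mul_nonneg (ind_nonneg _) (ind_nonneg _))
  linarith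

lemma tot_le_of_proper {X : Finset V} {χ : V → Fin 3} (hE : IsTriple E)
    (hχ : ∀ x ∈ X, ∀ y ∈ X, ∀ z ∈ X, E x y z → χ x ≠ χ y) :
    tot E X ≤ 6 * (cl X χ 0 * cl X χ 1 * cl X χ 2) := by
  have : tot E X ≤ ∑ x ∈ X, (ind (χ x = 0) * (2 * (cl X χ 1 * cl X χ 2)) +
      ind (χ x = 1) * (2 * (cl X χ 0 * cl X χ 2)) +
      ind (χ x = 2) * (2 * (cl X χ 0 * cl X χ 1))) := by
    refine sum_le_sum fun x hx => ?_
    have h3 : χ x = 0 ∨ χ x = 1 ∨ χ x = 2 := by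
      generalize χ x = a; revert a; decide
    rcases h3 with h | h | h
    · have := dg_le_of_proper hE hχ hx (j := 1) (k := 2) (by decide) (by decide) (by decide) h
      simpa [ind, h] using this
    · have := dg_le_of_proper hE hχ hx (j := 0) (k := 2) (by decide) (by decide) (by decide) h
      simpa [ind, h] using this
    · have := dg_le_of_proper hE hχ hx (j := 0) (k := 1) (by decide) (by decide) (by decide) h
      simpa [ind, h] using this
  rw [sum_add_distrib, sum_add_distrib, ← sum_mul, ← sum_mul, ← sum_mul, ← cl_eq_sum,
    ← cl_eq_sum, ← cl_eq_sum] at this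
  linarith

end Sets

/-- The number of edges of the balanced complete 3-partite 3-graph on `n` vertices. -/
def tau (n : ℕ) : ℕ := n / 3 * ((n + 1) / 3) * ((n + 2) / 3)

lemma tau_succ (n : ℕ) : tau (n + 1) = tau n + (n + 1) / 3 * ((n + 2) / 3) := by
  have : (n + 1 + 2) / 3 = n / 3 + 1 := by omega
  simp only [tau, this, show n + 1 + 1 = n + 2 from rfl]
  ring

lemma mul_le_of_le_third {a b c n : ℕ} (h : a + b + c = n + 1) (ha : a ≤ c) (hb : b ≤ c) :
    a * b ≤ (n + 1) / 3 * ((n + 2) / 3) := by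
  set q := (n + 1) / 3 with hq
  have h2 : (n + 2) / 3 = q ∧ a + b ≤ 2 * q ∨ (n + 2) / 3 = q + 1 ∧ a + b ≤ 2 * q + 1 := by omega
  clear_value q
  rcases h2 with ⟨h2, h3⟩ | ⟨h2, h3⟩
  · rw [h2]
    zify at h3 ⊢
    nlinarith [sq_nonneg ((a : ℤ) - b)]
  · rw [h2]
    rcases le_total a q with h4 | h4
    · obtain ⟨d, hd⟩ : ∃ d, q = a + d := ⟨q - a, by omega⟩
      clear hq h2
      subst hd
      have : b ≤ a + 2 * d + 1 := by omega
      calc a * b ≤ a * (a + 2 * d + 1) := by gcongr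
        _ ≤ _ := by nlinarith
    · rcases Nat.eq_or_lt_of_le h4 with h4 | h4
      · rw [← h4]; gcongr; omega
      · obtain ⟨d, rfl⟩ : ∃ d, a = q + 1 + d := ⟨a - q - 1, by omega⟩
        obtain ⟨e, he⟩ : ∃ e, q = b + d + e := ⟨q - b - d, by omega⟩
        clear hq h2
        subst he
        nlinarith

lemma mul_mul_le_tau (n : ℕ) : ∀ a b c : ℕ, a + b + c = n → a * b * c ≤ tau n := by
  induction n with
  | zero =>
    intro a b c h
    have : a = 0 := by omega
    simp [this]
  | succ n ih =>
    have key : ∀ a b c : ℕ, a + b + c = n + 1 → a ≤ c → b ≤ c → a * b * c ≤ tau (n + 1) := by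
      intro a b c h ha hb
      obtain ⟨d, rfl⟩ : ∃ d, c = d + 1 := ⟨c - 1, by omega⟩
      have h1 := ih a b d (by omega)
      have h2 := mul_le_of_le_third h ha hb
      rw [tau_succ]
      nlinarith
    intro a b c h
    rcases le_total a b with hab | hab
    · rcases le_total b c with hbc | hbc
      · exact key a b c h (hab.trans hbc) hbc
      · have := key a c b (by omega) hab hbc
        linarith [show a * b * c = a * c * b by ring]
    · rcases le_total a c with hac | hac
      · exact key a b c h hac (hab.trans hac)
      · have := key b c a (by omega) hab hac
        linarith [show a * b * c = b * c * a by ring]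

lemma tau_lower (n : ℕ) : (2 / 9 : ℝ) * n ^ 3 - 2 / 3 * n ^ 2 ≤ 6 * (tau n : ℝ) := by
  induction n with
  | zero => simp [tau]
  | succ n ih =>
    rw [tau_succ]
    have h1 : (n : ℝ) - 1 ≤ 3 * ((n + 1) / 3 : ℕ) := by
      have : n ≤ 3 * ((n + 1) / 3) + 1 := by omega
      have : (n : ℝ) ≤ 3 * ((n + 1) / 3 : ℕ) + 1 := by exact_mod_cast this
      linarith
    have h2 : (n : ℝ) ≤ 3 * ((n + 2) / 3 : ℕ) := by
      have : n ≤ 3 * ((n + 2) / 3) := by omega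
      exact_mod_cast this
    have h3 : ((n : ℝ) - 1) * n ≤ (3 * ((n + 1) / 3 : ℕ)) * (3 * ((n + 2) / 3 : ℕ)) := by
      have : (0 : ℝ) ≤ ((n + 1) / 3 : ℕ) := Nat.cast_nonneg _
      have : (0 : ℝ) ≤ n := Nat.cast_nonneg _
      calc ((n : ℝ) - 1) * n ≤ (3 * ((n + 1) / 3 : ℕ)) * n := by gcongr
        _ ≤ _ := by gcongr
    push_cast at h1 h2 h3 ⊢
    nlinarith

lemma tau_upper (n : ℕ) : 6 * (tau n : ℝ) ≤ 2 / 9 * (n : ℝ) ^ 3 := by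
  have h : ((n / 3 : ℕ) : ℝ) + ((n + 1) / 3 : ℕ) + ((n + 2) / 3 : ℕ) = n := by
    have : n / 3 + (n + 1) / 3 + (n + 2) / 3 = n := by omega
    exact_mod_cast this
  rw [← h, tau]
  push_cast
  have a0 : (0 : ℝ) ≤ (n / 3 : ℕ) := Nat.cast_nonneg _
  have b0 : (0 : ℝ) ≤ ((n + 1) / 3 : ℕ) := Nat.cast_nonneg _
  have c0 : (0 : ℝ) ≤ ((n + 2) / 3 : ℕ) := Nat.cast_nonneg _
  generalize ((n / 3 : ℕ) : ℝ) = a at *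
  generalize (((n + 1) / 3 : ℕ) : ℝ) = b at *
  generalize (((n + 2) / 3 : ℕ) : ℝ) = c at *
  nlinarith [mul_nonneg a0 (sq_nonneg (b - c)), mul_nonneg b0 (sq_nonneg (a - c)),
    mul_nonneg c0 (sq_nonneg (a - b)), mul_nonneg (add_nonneg (add_nonneg a0 b0) c0)
    (add_nonneg (add_nonneg (sq_nonneg (a - b)) (sq_nonneg (a - c))) (sq_nonneg (b - c)))]

/-- `6 * tau n - κ * n ^ 3` is increasing for large `n` when `κ < 2 / 9`. -/
lemma tau_sub_mono {δ : ℝ} (hδ : 0 < δ) (hδ1 : δ ≤ 1) {k n : ℕ} (hk : 2 / δ ≤ k) (hkn : k ≤ n) :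
    6 * (tau k : ℝ) - (2 / 9 - δ) * k ^ 3 ≤ 6 * (tau n : ℝ) - (2 / 9 - δ) * n ^ 3 := by
  induction n, hkn using Nat.le_induction with
  | base => exact le_rfl
  | succ n hkn ih =>
    refine ih.trans ?_
    rw [tau_succ]
    have hkn' : (k : ℝ) ≤ n := by exact_mod_cast hkn
    have hn : 2 ≤ δ * n := by
      rw [div_le_iff₀ hδ] at hk
      nlinarith
    have h1 : (n : ℝ) - 1 ≤ 3 * ((n + 1) / 3 : ℕ) := by
      have : n ≤ 3 * ((n + 1) / 3) + 1 := by omega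
      have : (n : ℝ) ≤ 3 * ((n + 1) / 3 : ℕ) + 1 := by exact_mod_cast this
      linarith
    have h2 : (n : ℝ) ≤ 3 * ((n + 2) / 3 : ℕ) := by
      have : n ≤ 3 * ((n + 2) / 3) := by omega
      exact_mod_cast this
    have h0 : (0 : ℝ) ≤ n := Nat.cast_nonneg _
    have h3 : ((n : ℝ) - 1) * n ≤ (3 * ((n + 1) / 3 : ℕ)) * (3 * ((n + 2) / 3 : ℕ)) := by
      have : (0 : ℝ) ≤ ((n + 1) / 3 : ℕ) := Nat.cast_nonneg _
      calc ((n : ℝ) - 1) * n ≤ (3 * ((n + 1) / 3 : ℕ)) * n := by gcongr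
        _ ≤ _ := by gcongr
    have h4 : 2 * (n : ℝ) ≤ δ * n * n := by gcongr
    have h5 : (2 : ℝ) ≤ n := by nlinarith
    push_cast at h1 h2 h3 ⊢
    nlinarith

/-- `degree_stability` for the 3-graph induced on a vertex set. -/
theorem degree_stability_on {m : ℕ} (hm : 2 ≤ m) :
    ∃ δ : ℝ, 0 < δ ∧ ∃ n0 : ℕ, ∀ (V : Type) (E : V → V → V → Prop) (X : Finset V), IsTriple E →
      CopFree E m X → n0 ≤ X.card →
      (∀ x ∈ X, (2 / 9 - δ) * (X.card : ℝ) ^ 2 ≤ dg E X x) →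
      ∃ χ : V → Fin 3, ∀ x ∈ X, ∀ y ∈ X, ∀ z ∈ X, E x y z → χ x ≠ χ y := by
  classical
  obtain ⟨δ, hδ, n0, H⟩ := degree_stability hm
  refine ⟨δ, hδ, n0, fun V E X hE hfree hn hdeg => ?_⟩
  set emb : X ↪ V := Function.Embedding.subtype _ with hemb
  obtain ⟨χ, hχ⟩ := H X (fun x y z => E x y z) (hE.comap emb) (by
    rintro U - ⟨A, B, C, w, a, a', hA, hB, hC, h, ha, ha', haa, hwA, hwB, hwC, he, hU⟩
    refine hfree (U.map emb) ?_ ⟨A.map emb, B.map emb, C.map emb, w, a, a', by simpa using hA,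
      by simpa using hB, by simpa using hC, ?_, ?_, ?_, ?_, ?_, ?_, ?_, he, ?_⟩
    · intro x hx
      obtain ⟨y, -, rfl⟩ := mem_map.1 hx
      exact y.2
    · intro x hx y hy z hz
      obtain ⟨x', hx', rfl⟩ := mem_map.1 hx
      obtain ⟨y', hy', rfl⟩ := mem_map.1 hy
      obtain ⟨z', hz', rfl⟩ := mem_map.1 hz
      exact h x' hx' y' hy' z' hz'
    · exact mem_map_of_mem emb ha
    · exact mem_map_of_mem emb ha'
    · exact fun e => haa (Subtype.ext e)
    · exact fun e => hwA ((mem_map' emb).1 e)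
    · exact fun e => hwB ((mem_map' emb).1 e)
    · exact fun e => hwC ((mem_map' emb).1 e)
    · intro x
      simp only [mem_map, hU]
      constructor
      · rintro ⟨y, hy | hy | hy | rfl, rfl⟩
        · exact Or.inl ⟨y, hy, rfl⟩
        · exact Or.inr (Or.inl ⟨y, hy, rfl⟩)
        · exact Or.inr (Or.inr (Or.inl ⟨y, hy, rfl⟩))
        · exact Or.inr (Or.inr (Or.inr rfl))
      · rintro (⟨y, hy, rfl⟩ | ⟨y, hy, rfl⟩ | ⟨y, hy, rfl⟩ | rfl)
        · exact ⟨y, Or.inl hy, rfl⟩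
        · exact ⟨y, Or.inr (Or.inl hy), rfl⟩
        · exact ⟨y, Or.inr (Or.inr (Or.inl hy)), rfl⟩
        · exact ⟨w, Or.inr (Or.inr (Or.inr rfl)), rfl⟩) (by rwa [Fintype.card_coe])
    (by
      intro x
      rw [Fintype.card_coe]
      refine (hdeg x x.2).trans (le_of_eq ?_)
      simp only [dg, cod]
      rw [← sum_coe_sort X (fun y => ∑ z ∈ X, ind (E x y z))]
      exact sum_congr rfl fun y _ => (sum_coe_sort X (fun z => ind (E x y z))).symm)
  refine ⟨fun v => if h : v ∈ X then χ ⟨v, h⟩ else 0, fun x hx y hy z hz h => ?_⟩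
  simp only [hx, hy, dif_pos]
  exact hχ ⟨x, hx⟩ ⟨y, hy⟩ ⟨z, hz⟩ h

/-- Variant of `degree_stability_on` with the degree condition supplied by `exists_core`. -/
lemma exists_coloring_of_core {m : ℕ} (hm : 2 ≤ m) :
    ∃ δ0 : ℝ, 0 < δ0 ∧ ∀ δ : ℝ, 0 < δ → δ ≤ δ0 → ∃ N : ℕ,
      ∀ (V : Type) (E : V → V → V → Prop) (Z : Finset V), IsTriple E →
      CopFree E m Z → N ≤ Z.card →
      (∀ x ∈ Z, (2 / 9 - δ) * ((Z.card : ℝ) ^ 2 - Z.card) ≤ dg E Z x) →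
      ∃ χ : V → Fin 3, ∀ x ∈ Z, ∀ y ∈ Z, ∀ z ∈ Z, E x y z → χ x ≠ χ y := by
  obtain ⟨δ, hδ, n0, H⟩ := degree_stability_on hm
  refine ⟨δ / 2, by positivity, fun δ' h0 h1 => ?_⟩
  obtain ⟨M, hM⟩ := exists_nat_ge (1 / δ')
  refine ⟨max n0 M, fun V E Z hE hfree hN hdeg => H V E Z hE hfree
    ((le_max_left _ _).trans hN) fun x hx => le_trans ?_ (hdeg x hx)⟩
  have hk : 1 / δ' ≤ (Z.card : ℝ) :=
    hM.trans (by exact_mod_cast (le_max_right _ _).trans hN)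
  rw [div_le_iff₀ h0] at hk
  have hk0 : (0 : ℝ) ≤ Z.card := Nat.cast_nonneg _
  nlinarith [mul_le_mul_of_nonneg_right hk hk0, mul_nonneg hk0 hk0,
    mul_nonneg (sub_nonneg.2 h1) (mul_nonneg hk0 hk0)]

lemma tot_le_tau_of_proper {V : Type} {E : V → V → V → Prop} {Z : Finset V} {χ : V → Fin 3}
    (hE : IsTriple E) (hχ : ∀ x ∈ Z, ∀ y ∈ Z, ∀ z ∈ Z, E x y z → χ x ≠ χ y) :
    tot E Z ≤ 6 * tau Z.card := by
  refine (tot_le_of_proper hE hχ).trans ?_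
  have h := mul_mul_le_tau _ _ _ _ (sum_cl_nat Z χ)
  have : cl Z χ 0 * cl Z χ 1 * cl Z χ 2 ≤ tau Z.card := by
    unfold cl
    exact_mod_cast h
  linarith

/-- The Turán bound for a single copy of `F_5^S(m)`. -/
theorem tot_le_tau {m : ℕ} (hm : 2 ≤ m) :
    ∃ n1 : ℕ, ∀ (V : Type) (E : V → V → V → Prop) (X : Finset V), IsTriple E →
      CopFree E m X → n1 ≤ X.card → tot E X ≤ 6 * tau X.card := by
  obtain ⟨δ0, hδ0, H⟩ := exists_coloring_of_core hm
  obtain ⟨δ, hδ, hδ1, hδ2⟩ : ∃ δ, 0 < δ ∧ δ ≤ δ0 ∧ δ ≤ 2 / 9 :=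
    ⟨min δ0 (2 / 9), by positivity, min_le_left _ _, min_le_right _ _⟩
  obtain ⟨N, hN⟩ := H δ hδ hδ1
  obtain ⟨M, hM⟩ := exists_nat_ge (2 / δ)
  refine ⟨max M ((max N M) ^ 3), fun V E X hE hfree hn => ?_⟩
  by_contra! hcon
  obtain ⟨Z, hZ, h1, h2⟩ := exists_core hE (2 / 9 - δ) (by linarith) X
  have hMn : 2 / δ ≤ (X.card : ℝ) := hM.trans (by exact_mod_cast (le_max_left _ _).trans hn)
  have hkey : max N M ≤ Z.card := by
    have h3 := tau_lower X.card
    have h4 := tot_le_cube (E := E) Z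
    have h5 : 0 ≤ (2 / 9 - δ) * (Z.card : ℝ) ^ 3 := mul_nonneg (by linarith) (by positivity)
    rw [div_le_iff₀ hδ] at hMn
    have hnn : (0 : ℝ) ≤ X.card := Nat.cast_nonneg _
    have h6 : (X.card : ℝ) ≤ (Z.card : ℝ) ^ 3 := by
      rcases Nat.eq_zero_or_pos X.card with h | h
      · rw [h]; push_cast; positivity
      · have h7 : (1 : ℝ) ≤ X.card := by exact_mod_cast h
        nlinarith [mul_le_mul_of_nonneg_right hMn (mul_nonneg hnn hnn),
          mul_le_mul_of_nonneg_right h7 hnn]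
    have h7 : X.card ≤ Z.card ^ 3 := by exact_mod_cast h6
    exact le_of_pow_le_pow_left₀ (by norm_num) (Nat.zero_le _)
      (((le_max_right _ _).trans hn).trans h7)
  obtain ⟨χ, hχ⟩ := hN V E Z hE (fun U hU => hfree U (hU.trans hZ))
    ((le_max_left _ _).trans hkey) h2
  have h3 := tot_le_tau_of_proper hE hχ
  have h4 := tau_sub_mono hδ (by linarith)
    (hM.trans (by exact_mod_cast (le_max_right _ _).trans hkey)) (card_le_card hZ)
  linarith

/-- In a 3-graph of almost extremal minimum degree no degree is much larger. -/
theorem dg_le_of_copFree {m : ℕ} (hm : 2 ≤ m) {ε : ℝ} (hε : 0 < ε) :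
    ∃ δ : ℝ, 0 < δ ∧ δ ≤ 1 / 9 ∧ ∃ N : ℕ,
      ∀ (V : Type) (E : V → V → V → Prop) (X : Finset V), IsTriple E →
      CopFree E m X → N ≤ X.card →
      (∀ x ∈ X, (2 / 9 - δ) * (X.card : ℝ) ^ 2 ≤ dg E X x) →
      ∀ v ∈ X, dg E X v ≤ (2 / 9 + ε) * (X.card : ℝ) ^ 2 := by
  obtain ⟨δ0, hδ0, N, H⟩ := degree_stability_on hm
  obtain ⟨δ, hδ, hδ1, hδ2, hδ3⟩ : ∃ δ, 0 < δ ∧ δ ≤ δ0 ∧ δ ≤ 1 / 9 ∧ δ ≤ ε / 8 :=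
    ⟨min δ0 (min (1 / 9) (ε / 8)), by positivity, min_le_left _ _,
      (min_le_right _ _).trans (min_le_left _ _), (min_le_right _ _).trans (min_le_right _ _)⟩
  refine ⟨δ, hδ, hδ2, max N 1, fun V E X hE hfree hN hdeg v hv => ?_⟩
  obtain ⟨χ, hχ⟩ := H V E X hE hfree ((le_max_left _ _).trans hN) fun x hx =>
    le_trans (by gcongr) (hdeg x hx)
  have hn1 : (1 : ℝ) ≤ X.card := by exact_mod_cast (le_max_right _ _).trans hN
  have hpos : 0 < dg E X v := by
    refine lt_of_lt_of_le ?_ (hdeg v hv)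
    have : (0 : ℝ) < X.card := by linarith
    have : 0 < 2 / 9 - δ := by linarith
    positivity
  obtain ⟨y, hy, hy'⟩ := exists_lt_of_sum_lt (by simpa [dg] using hpos :
    ∑ y ∈ X, (0 : ℝ) < ∑ y ∈ X, ∑ z ∈ X, ind (E v y z))
  obtain ⟨z, hz, hz'⟩ := exists_lt_of_sum_lt (by simpa using hy' :
    ∑ z ∈ X, (0 : ℝ) < ∑ z ∈ X, ind (E v y z))
  have he : E v y z := (ind_pos_iff).1 hz'
  have hvy := hχ v hv y hy z hz he
  have hvz := hχ v hv z hz y hy (hE.swap23 he)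
  have hyz := hχ y hy z hz v hv (hE.rot he)
  have b1 := dg_le_of_proper hE hχ hv hvy hvz hyz rfl
  have b2 := dg_le_of_proper hE hχ hy hvy.symm hyz hvz rfl
  have b3 := dg_le_of_proper hE hχ hz hvz.symm hyz.symm hvy rfl
  have c2 := (hdeg y hy).trans b2
  have c3 := (hdeg z hz).trans b3
  have hsum : cl X χ (χ v) + cl X χ (χ y) + cl X χ (χ z) = X.card := by
    have h := sum_cl_nat X χ
    have h' : cl X χ 0 + cl X χ 1 + cl X χ 2 = X.card := by unfold cl; exact_mod_cast h
    rw [← h']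
    clear b1 b2 b3 c2 c3 he
    generalize cl X χ = f
    generalize χ v = i at *
    generalize χ y = j at *
    generalize χ z = k at *
    fin_cases i <;> fin_cases j <;> fin_cases k <;> first | (exfalso; revert hvy hvz hyz; decide) | (simp; try ring)
  have p1 := cl_nonneg X χ (χ v)
  have p2 := cl_nonneg X χ (χ y)
  have p3 := cl_nonneg X χ (χ z)
  generalize cl X χ (χ v) = a at *
  generalize cl X χ (χ y) = b at *
  generalize cl X χ (χ z) = c at *
  generalize (X.card : ℝ) = n at *
  subst hsum
  have d1 : a * (b + c) ≥ (2 / 9 - δ) * (a + b + c) ^ 2 := by linarith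
  have d2 : b + c ≤ (2 / 3 + 3 * δ) * (a + b + c) := by
    by_contra! hc
    have e1 : 0 ≤ (b + c - (2 / 3 + 3 * δ) * (a + b + c)) *
        (b + c + (2 / 3 + 3 * δ) * (a + b + c) - (a + b + c)) := by
      refine mul_nonneg (by linarith) ?_
      nlinarith
    have e2 : 0 < 9 * δ ^ 2 * (a + b + c) ^ 2 := by
      have : 0 < a + b + c := by linarith
      positivity
    nlinarith
  have d3 : 4 * (b * c) ≤ (b + c) ^ 2 := by nlinarith [sq_nonneg (b - c)]
  have d4 : (b + c) ^ 2 ≤ ((2 / 3 + 3 * δ) * (a + b + c)) ^ 2 := by gcongr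
  have d5 : (2 / 3 + 3 * δ) ^ 2 ≤ 2 * (2 / 9 + ε) := by nlinarith
  have d6 := mul_le_mul_of_nonneg_right d5 (sq_nonneg (a + b + c))
  nlinarith

section Peeling
variable {V : Type} {E : V → V → V → Prop}

lemma CopFree.mono {m : ℕ} {X Y : Finset V} (h : CopFree E m X) (hYX : Y ⊆ X) : CopFree E m Y :=
  fun U hU => h U (hU.trans hYX)

set_option maxHeartbeats 1000000 in
/-- A vertex `v` all of whose copies can be destroyed by few vertices has degree at most about
`2 / 9 * n ^ 2`, provided the whole 3-graph is dense and nearly free of copies. -/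
lemma dg_le_of_hitting {m : ℕ} (hm : 2 ≤ m) (K : ℕ) {ε : ℝ} (hε : 0 < ε) :
    ∃ (R : ℝ) (n0 : ℕ), 0 ≤ R ∧ ∀ (V : Type) [DecidableEq V] (E : V → V → V → Prop) (X S W : Finset V) (v : V),
      IsTriple E → n0 ≤ X.card → CopFree E m (X \ S) → S ⊆ X → S.card ≤ K →
      v ∈ X → W ⊆ X → v ∉ W → W.card ≤ K → (∀ U ⊆ X \ W, v ∈ U → ¬ IsCop E m U) →
      2 / 9 * (X.card : ℝ) ^ 3 ≤ tot E X →
      dg E X v ≤ (2 / 9 + ε) * (X.card : ℝ) ^ 2 + 2 * X.card * R := by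
  obtain ⟨δ, hδ, hδ9, N1, H1⟩ := dg_le_of_copFree hm hε
  obtain ⟨n1, H2⟩ := tot_le_tau hm
  obtain ⟨η, hη⟩ : ∃ η, η = δ / 2 := ⟨_, rfl⟩
  have hη0 : 0 < η := by rw [hη]; positivity
  obtain ⟨D, hD⟩ : ∃ D : ℕ, D = 2 * K + 1 := ⟨_, rfl⟩
  obtain ⟨M, hM⟩ := exists_nat_ge ((3 * D + 1) / η)
  obtain ⟨M2, hM2⟩ := exists_nat_ge (2 / η)
  obtain ⟨N, hN⟩ : ∃ N : ℕ, N = max (max N1 n1) (max M2 1) := ⟨_, rfl⟩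
  refine ⟨3 * D / η, max M (N ^ 3), by positivity, fun V _ E X S W v hE hn hfree hSX hSK hv hWX hvW
    hWK hhit htot => ?_⟩
  have hMn : (3 * D + 1) / η ≤ (X.card : ℝ) :=
    hM.trans (by exact_mod_cast (le_max_left _ _).trans hn)
  rw [div_le_iff₀ hη0] at hMn
  have hn0 : (0 : ℝ) ≤ X.card := Nat.cast_nonneg _
  have hn1 : (1 : ℝ) ≤ X.card := by
    exact_mod_cast card_pos.2 ⟨v, hv⟩
  set Y : Finset V := X \ (S ∪ insert v W) with hY
  have hrem : S ∪ insert v W ⊆ X := union_subset hSX (insert_subset hv hWX)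
  have hremc : ((S ∪ insert v W).card : ℝ) ≤ D := by
    have h1 := card_union_le S (insert v W)
    have h2 := card_insert_le v W
    have : (S ∪ insert v W).card ≤ D := by omega
    exact_mod_cast this
  have hYtot : tot E X ≤ tot E Y + 3 * (D * (X.card : ℝ) ^ 2) := by
    have h1 := tot_le_sdiff hE X hrem
    have h2 : ∑ x ∈ S ∪ insert v W, dg E X x ≤ D * (X.card : ℝ) ^ 2 := by
      calc _ ≤ ∑ x ∈ S ∪ insert v W, (X.card : ℝ) ^ 2 := sum_le_sum fun _ _ => dg_le_sq _ _
        _ ≤ _ := by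
          rw [sum_const, nsmul_eq_mul]
          gcongr
    linarith
  obtain ⟨Z, hZY, hZtot, hZdeg⟩ := exists_core hE (2 / 9 - η) (by linarith) Y
  have hYX : (Y.card : ℝ) ≤ X.card := by exact_mod_cast card_le_card sdiff_subset
  have hZX : Z ⊆ X := hZY.trans sdiff_subset
  have hvZ : v ∉ Z := fun h => (mem_sdiff.1 (hZY h)).2 (by simp)
  have hZlow : η * (X.card : ℝ) ^ 3 - 3 * D * (X.card : ℝ) ^ 2 ≤
      tot E Z - (2 / 9 - η) * (Z.card : ℝ) ^ 3 := by
    have h1 : (Y.card : ℝ) ^ 3 ≤ (X.card : ℝ) ^ 3 := by gcongr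
    have h2 : (2 / 9 - η) * (Y.card : ℝ) ^ 3 ≤ (2 / 9 - η) * (X.card : ℝ) ^ 3 :=
      mul_le_mul_of_nonneg_left h1 (by linarith)
    linarith
  have hNZ : N ≤ Z.card := by
    have h4 := tot_le_cube (E := E) Z
    have h5 : 0 ≤ (2 / 9 - η) * (Z.card : ℝ) ^ 3 := mul_nonneg (by linarith) (by positivity)
    have h6 : (X.card : ℝ) ≤ (Z.card : ℝ) ^ 3 := by
      nlinarith [mul_le_mul_of_nonneg_right hMn (mul_nonneg hn0 hn0),
        mul_le_mul_of_nonneg_right hn1 hn0]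
    have h7 : X.card ≤ Z.card ^ 3 := by exact_mod_cast h6
    exact le_of_pow_le_pow_left₀ (by norm_num) (Nat.zero_le _)
      (((le_max_right _ _).trans hn).trans h7)
  have hZfree : CopFree E m Z := hfree.mono fun x hx => by
    have := hZY hx
    simp only [hY, mem_sdiff, mem_union, not_or] at this
    exact mem_sdiff.2 ⟨this.1, this.2.1⟩
  have hk2 : (2 : ℝ) ≤ η * Z.card := by
    have h : 2 / η ≤ (Z.card : ℝ) := hM2.trans (by
      have : M2 ≤ Z.card := le_trans (by simp [hN]) hNZ
      exact_mod_cast this)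
    rw [div_le_iff₀ hη0] at h
    linarith
  have hk1 : (1 : ℝ) ≤ Z.card := by
    have : 1 ≤ Z.card := le_trans (by simp [hN]) hNZ
    exact_mod_cast this
  have hgap : (X.card : ℝ) - Z.card ≤ 3 * D / η := by
    have h1 := (H2 V E Z hE hZfree (le_trans (by simp [hN]) hNZ)).trans (tau_upper _)
    have hk : (Z.card : ℝ) ≤ X.card := by exact_mod_cast card_le_card hZX
    rw [le_div_iff₀ hη0]
    have h2 : η * ((X.card : ℝ) ^ 3 - (Z.card : ℝ) ^ 3) ≤ 3 * D * (X.card : ℝ) ^ 2 := by linarith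
    have h3 : ((X.card : ℝ) - Z.card) * (X.card : ℝ) ^ 2 ≤
        (X.card : ℝ) ^ 3 - (Z.card : ℝ) ^ 3 := by
      have : (Z.card : ℝ) * Z.card ^ 2 ≤ Z.card * (X.card : ℝ) ^ 2 := by gcongr
      nlinarith
    have h4 : 0 < (X.card : ℝ) ^ 2 := by positivity
    refine le_of_mul_le_mul_right ?_ h4
    nlinarith [mul_le_mul_of_nonneg_left h3 hη0.le]
  have hZ'X : insert v Z ⊆ X := insert_subset hv hZX
  have hcard : ((insert v Z).card : ℝ) = Z.card + 1 := by
    rw [card_insert_of_notMem hvZ]; push_cast; rfl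
  have hle : ((insert v Z).card : ℝ) ≤ X.card := by exact_mod_cast card_le_card hZ'X
  have hdgZ' : dg E (insert v Z) v ≤ (2 / 9 + ε) * (X.card : ℝ) ^ 2 := by
    by_cases hc : (2 / 9 - δ) * ((insert v Z).card : ℝ) ^ 2 ≤ dg E (insert v Z) v
    · refine (H1 V E (insert v Z) hE ?_ ?_ ?_ v (mem_insert_self _ _)).trans ?_
      · intro U hU hcop
        by_cases hvU : v ∈ U
        · refine hhit U (fun x hx => mem_sdiff.2 ⟨hZ'X (hU hx), ?_⟩) hvU hcop
          rcases mem_insert.1 (hU hx) with rfl | h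
          · exact hvW
          · have := hZY h
            simp only [hY, mem_sdiff, mem_union, mem_insert, not_or] at this
            exact this.2.2.2
        · refine hZfree U (fun x hx => ?_) hcop
          rcases mem_insert.1 (hU hx) with rfl | h
          · exact absurd hx hvU
          · exact h
      · have : N1 ≤ Z.card := le_trans (by simp [hN]) hNZ
        exact this.trans (card_le_card (subset_insert _ _))
      · intro x hx
        rcases mem_insert.1 hx with rfl | h
        · exact hc
        · refine le_trans ?_ ((hZdeg x h).trans (dg_mono (subset_insert _ _) x))
          rw [hcard]
          have : δ = 2 * η := by rw [hη]; ring
          rw [this]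
          nlinarith [mul_le_mul_of_nonneg_right hk2 (Nat.cast_nonneg (α := ℝ) Z.card)]
      · gcongr
    · push Not at hc
      refine hc.le.trans ?_
      have : ((insert v Z).card : ℝ) ^ 2 ≤ (X.card : ℝ) ^ 2 := by gcongr
      nlinarith [sq_nonneg (X.card : ℝ)]
  have h1 := dg_le_add (E := E) hZ'X v
  have h2 : ((X \ insert v Z).card : ℝ) ≤ 3 * D / η := by
    have h3 : ((X \ insert v Z).card : ℝ) + (insert v Z).card = X.card := by
      exact_mod_cast card_sdiff_add_card_eq_card hZ'X
    rw [hcard] at h3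
    linarith
  have h3 : 2 * (X.card : ℝ) * ((X \ insert v Z).card : ℝ) ≤ 2 * X.card * (3 * D / η) := by gcongr
  linarith

/-- If every vertex has a small set meeting all copies through it, and a small set meets all
copies, then the 3-graph has at most about `2 / 9 * n ^ 3` ordered edges. -/
lemma tot_le_of_hitting {m : ℕ} (hm : 2 ≤ m) (K : ℕ) :
    ∃ n0 : ℕ, ∀ (V : Type) [DecidableEq V] (E : V → V → V → Prop) (X S : Finset V),
      IsTriple E → n0 ≤ X.card → CopFree E m (X \ S) → S ⊆ X → S.card ≤ K →
      (∀ v ∈ X, ∃ W ⊆ X, v ∉ W ∧ W.card ≤ K ∧ ∀ U ⊆ X \ W, v ∈ U → ¬ IsCop E m U) →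
      tot E X ≤ 2 / 9 * (X.card : ℝ) ^ 3 + (X.card : ℝ) ^ 2 := by
  obtain ⟨ε, hε⟩ : ∃ ε : ℝ, ε = 1 / (6 * (K + 1)) := ⟨_, rfl⟩
  have hε0 : 0 < ε := by rw [hε]; positivity
  obtain ⟨R, n0, hR, H⟩ := dg_le_of_hitting hm K hε0
  obtain ⟨n1, H2⟩ := tot_le_tau hm
  obtain ⟨M, hM⟩ := exists_nat_ge (2 * (6 * K * R + (K : ℝ) ^ 2))
  refine ⟨max n0 (max M (n1 + K)), fun V _ E X S hE hn hfree hSX hSK hW => ?_⟩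
  by_contra! hcon
  have hnM : 2 * (6 * K * R + (K : ℝ) ^ 2) ≤ X.card := hM.trans (by
    have : M ≤ X.card := le_trans (by simp) hn
    exact_mod_cast this)
  have hsd := card_sdiff_add_card_eq_card hSX
  have h1 : tot E (X \ S) ≤ 2 / 9 * ((X \ S).card : ℝ) ^ 3 := by
    refine (H2 V E _ hE hfree ?_).trans (tau_upper _)
    have : n1 + K ≤ X.card := le_trans (by simp) hn
    omega
  have h2 : ∑ v ∈ S, dg E X v ≤
      S.card * ((2 / 9 + ε) * (X.card : ℝ) ^ 2 + 2 * X.card * R) := by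
    rw [← nsmul_eq_mul, ← sum_const]
    refine sum_le_sum fun v hv => ?_
    obtain ⟨W, hWX, hvW, hWK, hhit⟩ := hW v (hSX hv)
    exact H V E X S W v hE (le_trans (by simp) hn) hfree hSX hSK (hSX hv) hWX hvW hWK hhit
      (by nlinarith [sq_nonneg (X.card : ℝ)])
  have h3 := tot_le_sdiff hE X hSX
  have h4 : ((X \ S).card : ℝ) = X.card - S.card := by
    rw [eq_sub_iff_add_eq]; exact_mod_cast hsd
  have hs : (S.card : ℝ) ≤ K := by exact_mod_cast hSK
  have hs0 : (0 : ℝ) ≤ S.card := Nat.cast_nonneg _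
  have hn0 : (0 : ℝ) ≤ X.card := Nat.cast_nonneg _
  rw [h4] at h1
  have hsε : 3 * (S.card : ℝ) * ε ≤ 1 / 2 := by
    rw [hε, mul_one_div, div_le_iff₀ (by positivity)]
    linarith
  generalize (S.card : ℝ) = s at *
  generalize (X.card : ℝ) = n at *
  have h5 : s * n * R ≤ K * n * R := by gcongr
  have h6 : s ^ 2 * n ≤ K ^ 2 * n := by gcongr
  have h7 := mul_le_mul_of_nonneg_right hsε (sq_nonneg n)
  have h8 := mul_le_mul_of_nonneg_right hnM hn0
  have h9 : 0 ≤ s ^ 3 := by positivity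
  nlinarith

/-- The vertex set `X` contains `k` disjoint copies of `F_5^S(m)`. -/
def HasCopies (E : V → V → V → Prop) (m : ℕ) : ℕ → Finset V → Prop
  | 0, _ => True
  | k + 1, X => ∃ U Y : Finset V, U ⊆ X ∧ Y ⊆ X ∧ Disjoint U Y ∧ IsCop E m U ∧ HasCopies E m k Y

lemma HasCopies.mono {m : ℕ} : ∀ {k : ℕ} {X X' : Finset V}, HasCopies E m k X → X ⊆ X' →
    HasCopies E m k X'
  | 0, _, _, _, _ => trivial
  | _ + 1, _, _, ⟨U, Y, hU, hY, hd, hc, h⟩, hX =>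
    ⟨U, Y, hU.trans hX, hY.trans hX, hd, hc, h⟩

lemma IsCop.card_le {m : ℕ} {U : Finset V} (h : IsCop E m U) : U.card ≤ 3 * m + 1 := by
  classical
  obtain ⟨A, B, C, w, a, a', hA, hB, hC, -, -, -, -, -, -, -, -, hU⟩ := h
  have : U = A ∪ B ∪ C ∪ {w} := by
    ext x
    simp only [hU, mem_union, mem_singleton, or_assoc]
  rw [this]
  have h1 := card_union_le (A ∪ B ∪ C) {w}
  have h2 := card_union_le (A ∪ B) C
  have h3 := card_union_le A B
  rw [card_singleton] at h1
  omega

lemma HasCopies.exists_small {m k : ℕ} : ∀ {X : Finset V}, HasCopies E m k X →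
    ∃ W ⊆ X, W.card ≤ k * (3 * m + 1) ∧ HasCopies E m k W := by
  classical
  induction k with
  | zero => exact fun _ => ⟨∅, by simp, by simp, trivial⟩
  | succ k ih =>
    rintro X ⟨U, Y, hU, hY, hd, hc, h⟩
    obtain ⟨W, hWY, hW, hWc⟩ := ih h
    refine ⟨U ∪ W, union_subset hU (hWY.trans hY), ?_, U, W, subset_union_left,
      subset_union_right, hd.mono_right hWY, hc, hWc⟩
    have h1 := card_union_le U W
    have h2 := hc.card_le
    rw [add_mul]
    omega

lemma exists_hitting_of_not_hasCopies [DecidableEq V] {m k : ℕ} : ∀ {X : Finset V},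
    ¬ HasCopies E m (k + 1) X → ∃ S ⊆ X, S.card ≤ k * (3 * m + 1) ∧ CopFree E m (X \ S) := by
  induction k with
  | zero =>
    intro X h
    refine ⟨∅, by simp, by simp, fun U hU hc => h ⟨U, ∅, ?_, by simp, by simp, hc, trivial⟩⟩
    simpa using hU
  | succ k ih =>
    intro X h
    by_cases hX : CopFree E m X
    · exact ⟨∅, by simp, by simp, by simpa using hX⟩
    · simp only [CopFree, not_forall, not_not] at hX
      obtain ⟨U, hU, hc⟩ := hX
      obtain ⟨S, hS, hSc, hfree⟩ := ih (X := X \ U) fun h' =>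
        h ⟨U, X \ U, hU, sdiff_subset, disjoint_sdiff, hc, h'⟩
      refine ⟨U ∪ S, union_subset hU (hS.trans sdiff_subset), ?_, ?_⟩
      · have h1 := card_union_le U S
        have h2 := hc.card_le
        rw [add_mul]
        omega
      · rwa [← sup_eq_union, ← sdiff_sdiff_left]

lemma dg_le_mul_pred [DecidableEq V] (hE : IsTriple E) {X : Finset V} {v : V} (hv : v ∈ X) :
    dg E X v ≤ ((X.card : ℝ) - 1) * (X.card - 2) := by
  have h0 : dg E X v = ∑ y ∈ X.erase v, ∑ z ∈ X, ind (E v y z) := by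
    rw [dg, ← add_sum_erase _ _ hv, sum_eq_zero fun z _ => ind_of_not fun h => hE.ne12 h rfl,
      zero_add]
  have hc1 : ((X.erase v).card : ℝ) = X.card - 1 := by
    rw [eq_sub_iff_add_eq]; exact_mod_cast card_erase_add_one hv
  rw [h0, ← hc1, ← nsmul_eq_mul, ← sum_const]
  refine sum_le_sum fun y hy => ?_
  have hc2 : (((X.erase v).erase y).card : ℝ) = X.card - 2 := by
    have : (((X.erase v).erase y).card : ℝ) + 1 = (X.erase v).card := by
      exact_mod_cast card_erase_add_one hy
    linarith
  rw [← hc2]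
  calc ∑ z ∈ X, ind (E v y z) = ∑ z ∈ (X.erase v).erase y, ind (E v y z) := by
        refine (sum_subset ((erase_subset _ _).trans (erase_subset _ _)) fun z hz hz' => ?_).symm
        refine ind_of_not fun h => hz' ?_
        rw [mem_erase, mem_erase]
        exact ⟨(hE.ne23 h).symm, (hE.ne13 h).symm, hz⟩
    _ ≤ ∑ z ∈ (X.erase v).erase y, (1 : ℝ) := sum_le_sum fun _ _ => ind_le_one _
    _ = _ := by simp

end Peeling

/-- The number of edges of `G(t, m, n)`. -/
def gval (t n : ℕ) : ℕ := tau (n - t) + (n.choose 3 - (n - t).choose 3)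

lemma gval_succ (t n : ℕ) : gval (t + 1) (n + 1) = gval t n + n.choose 2 := by
  have h1 : n + 1 - (t + 1) = n - t := by omega
  have h2 : (n - t).choose 3 ≤ n.choose 3 := Nat.choose_le_choose 3 (Nat.sub_le _ _)
  have h3 : (n + 1).choose 3 = n.choose 2 + n.choose 3 := Nat.choose_succ_succ n 2
  simp only [gval, h1, h3]
  omega

lemma six_gval_succ (t n : ℕ) :
    6 * (gval (t + 1) (n + 1) : ℝ) = 6 * gval t n + 3 * (n * (n - 1)) := by
  rw [gval_succ]
  push_cast
  rw [Nat.cast_choose_two]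
  ring

lemma gval_lower (t : ℕ) : ∀ n : ℕ, t + 11 ≤ n →
    2 / 9 * (n : ℝ) ^ 3 + (n : ℝ) ^ 2 ≤ 6 * gval (t + 1) n := by
  induction t with
  | zero =>
    intro n hn
    obtain ⟨k, rfl⟩ : ∃ k, n = k + 1 := ⟨n - 1, by omega⟩
    rw [six_gval_succ]
    have h1 := tau_lower k
    have h2 : gval 0 k = tau k := by simp [gval]
    have h3 : (10 : ℝ) ≤ k := by exact_mod_cast (by omega : 10 ≤ k)
    rw [h2]
    push_cast
    nlinarith
  | succ t ih =>
    intro n hn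
    obtain ⟨k, rfl⟩ : ∃ k, n = k + 1 := ⟨n - 1, by omega⟩
    rw [six_gval_succ]
    have h1 := ih k (by omega)
    have h3 : (10 : ℝ) ≤ k := by exact_mod_cast (by omega : 10 ≤ k)
    push_cast
    nlinarith

/-- The Turán bound for disjoint copies of `F_5^S(m)`. -/
theorem tot_le_gval {m : ℕ} (hm : 2 ≤ m) (t : ℕ) :
    ∃ n0 : ℕ, ∀ (V : Type) (E : V → V → V → Prop) (X : Finset V), IsTriple E →
      n0 ≤ X.card → ¬ HasCopies E m (t + 1) X → tot E X ≤ 6 * gval t X.card := by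
  classical
  induction t with
  | zero =>
    obtain ⟨n0, H⟩ := tot_le_tau hm
    refine ⟨n0, fun V E X hE hn h => ?_⟩
    have h0 : gval 0 X.card = tau X.card := by simp [gval]
    rw [h0]
    refine H V E X hE (fun U hU hc => h ⟨U, ∅, hU, by simp, by simp, hc, trivial⟩) hn
  | succ t ih =>
    obtain ⟨n0, H⟩ := ih
    obtain ⟨n1, H1⟩ := tot_le_of_hitting hm ((t + 1) * (3 * m + 1))
    refine ⟨max (n0 + 1) (max n1 (t + 11)), fun V E X hE hn h => ?_⟩
    by_cases hrob : ∃ v ∈ X, ∀ W ⊆ X, v ∉ W → W.card ≤ (t + 1) * (3 * m + 1) →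
        ∃ U ⊆ X \ W, v ∈ U ∧ IsCop E m U
    · obtain ⟨v, hv, hrob⟩ := hrob
      have hlow : n0 + 1 ≤ X.card := le_trans (by simp) hn
      have hcard := card_erase_add_one hv
      have h1 := H V E (X.erase v) hE (by omega) fun hc => by
        obtain ⟨W, hWX, hW, hWc⟩ := hc.exists_small
        obtain ⟨U, hU, -, hUc⟩ := hrob W (hWX.trans (erase_subset _ _))
          (fun hvW => notMem_erase v X (hWX hvW)) hW
        exact h ⟨U, W, hU.trans sdiff_subset, hWX.trans (erase_subset _ _),
          disjoint_of_subset_left hU sdiff_disjoint, hUc, hWc⟩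
      have h2 := tot_le_erase hE hv
      have h3 := dg_le_mul_pred hE hv
      have h4 := six_gval_succ t (X.erase v).card
      rw [hcard] at h4
      have h5 : ((X.erase v).card : ℝ) = X.card - 1 := by
        rw [eq_sub_iff_add_eq]; exact_mod_cast hcard
      rw [h4]
      rw [h5]
      linarith
    · push Not at hrob
      obtain ⟨S, hS, hSc, hfree⟩ := exists_hitting_of_not_hasCopies h
      refine (H1 V E X S hE (le_trans (by simp) hn) hfree hS hSc fun v hv => ?_).trans
        (gval_lower t _ (le_trans (by simp) hn))
      exact hrob v hv

section Hypergraph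
variable {V : Type} [DecidableEq V]

/-- The ternary relation of a 3-graph given by its edge set. -/
def tripleRel (H : Finset (Finset V)) (x y z : V) : Prop :=
  x ≠ y ∧ x ≠ z ∧ y ≠ z ∧ ({x, y, z} : Finset V) ∈ H

lemma tripleRel_isTriple (H : Finset (Finset V)) : IsTriple (tripleRel H) where
  swap12 := fun ⟨h1, h2, h3, h4⟩ => ⟨h1.symm, h3, h2, by rwa [insert_comm]⟩
  swap23 := fun {x y z} ⟨h1, h2, h3, h4⟩ => ⟨h2, h1, h3.symm, by rwa [pair_comm z y]⟩
  ne12 := fun h => h.1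

lemma card_le_tot [Fintype V] (H : Finset (Finset V)) (hH : ∀ e ∈ H, e.card = 3) :
    6 * (H.card : ℝ) ≤ tot (tripleRel H) univ := by
  classical
  set P : Finset (V × V × V) := univ.filter fun p => tripleRel H p.1 p.2.1 p.2.2 with hP
  have h1 : tot (tripleRel H) univ = P.card := by
    rw [hP, card_filter]
    push_cast
    rw [Fintype.sum_prod_type]
    simp only [Fintype.sum_prod_type]
    exact sum_congr rfl fun x _ => sum_congr rfl fun y _ => sum_congr rfl fun z _ => by
      unfold ind; congr
  have h2 := card_eq_sum_card_fiberwise (s := P) (t := H)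
    (f := fun p => ({p.1, p.2.1, p.2.2} : Finset V)) (by
      intro p hp
      simp only [hP, coe_filter, mem_univ, true_and, Set.mem_ofPred_eq] at hp
      exact hp.2.2.2)
  have h3 : H.card • 6 ≤ P.card := by
    rw [h2]
    refine card_nsmul_le_sum _ _ _ fun e he => ?_
    obtain ⟨a, b, c, hab, hac, hbc, rfl⟩ := card_eq_three.1 (hH e he)
    have hT : tripleRel H a b c := ⟨hab, hac, hbc, he⟩
    have hI := tripleRel_isTriple H
    have hsub : ({(a, b, c), (a, c, b), (b, a, c), (b, c, a), (c, a, b), (c, b, a)} :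
        Finset (V × V × V)) ⊆ P.filter fun p => ({p.1, p.2.1, p.2.2} : Finset V) = {a, b, c} := by
      intro p hp
      simp only [mem_insert, mem_singleton] at hp
      simp only [hP, mem_filter, mem_univ, true_and]
      rcases hp with rfl | rfl | rfl | rfl | rfl | rfl
      · exact ⟨hT, rfl⟩
      · exact ⟨hI.swap23 hT, by ext x; simp; tauto⟩
      · exact ⟨hI.swap12 hT, by ext x; simp; tauto⟩
      · exact ⟨hI.rot hT, by ext x; simp; tauto⟩
      · exact ⟨hI.rot (hI.rot hT), by ext x; simp; tauto⟩
      · exact ⟨hI.swap12 (hI.rot hT), by ext x; simp; tauto⟩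
    refine le_trans (le_of_eq ?_) (card_le_card hsub)
    simp [card_insert_of_notMem, hab, hac, hbc, hab.symm, hac.symm, hbc.symm]
  rw [h1]
  rw [smul_eq_mul, mul_comm] at h3
  exact_mod_cast h3

lemma rainbow_iff (c : Fin 3 → V → Prop) [∀ i, DecidablePred (c i)]
    (hc : ∀ i j x, c i x → c j x → i = j) (e : Finset V) :
    (e.card = 3 ∧ ∀ i, (e.filter (c i)).card = 1) ↔
      ∃ p q r, c 0 p ∧ c 1 q ∧ c 2 r ∧ e = {p, q, r} := by
  constructor
  · rintro ⟨h3, h⟩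
    have key : ∀ i, ∃ p, p ∈ e ∧ c i p := fun i => by
      obtain ⟨p, hp⟩ := card_pos.1 (by rw [h i]; exact one_pos)
      exact ⟨p, mem_filter.1 hp⟩
    obtain ⟨p, hp, hp'⟩ := key 0
    obtain ⟨q, hq, hq'⟩ := key 1
    obtain ⟨r, hr, hr'⟩ := key 2
    refine ⟨p, q, r, hp', hq', hr', (eq_of_subset_of_card_le ?_ ?_).symm⟩
    · intro x hx
      simp only [mem_insert, mem_singleton] at hx
      rcases hx with rfl | rfl | rfl <;> assumption
    · rw [h3, card_eq_three.2 ⟨p, q, r, ?_, ?_, ?_, rfl⟩]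
      · rintro rfl; exact absurd (hc _ _ _ hp' hq') (by decide)
      · rintro rfl; exact absurd (hc _ _ _ hp' hr') (by decide)
      · rintro rfl; exact absurd (hc _ _ _ hq' hr') (by decide)
  · rintro ⟨p, q, r, hp, hq, hr, rfl⟩
    refine ⟨card_eq_three.2 ⟨p, q, r, ?_, ?_, ?_, rfl⟩, fun i => ?_⟩
    · rintro rfl; exact absurd (hc _ _ _ hp hq) (by decide)
    · rintro rfl; exact absurd (hc _ _ _ hp hr) (by decide)
    · rintro rfl; exact absurd (hc _ _ _ hq hr) (by decide)
    · have hi : i = 0 ∨ i = 1 ∨ i = 2 := by revert i; decide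
      rw [card_eq_one]
      have no : ∀ {i j : Fin 3} {x : V}, c i x → j ≠ i → ¬ c j x := fun hx hij h =>
        hij (hc _ _ _ h hx)
      rcases hi with rfl | rfl | rfl
      · exact ⟨p, by simp [filter_insert, filter_singleton, hp, no hq, no hr]⟩
      · exact ⟨q, by simp [filter_insert, filter_singleton, hq, no hp, no hr]⟩
      · exact ⟨r, by simp [filter_insert, filter_singleton, hr, no hp, no hq]⟩

end Hypergraph

lemma mem_T3_iff {n : ℕ} {e : Finset (Fin n)} :
    e ∈ T3 n ↔ ∃ p q r : Fin n, (p : ℕ) % 3 = 0 ∧ (q : ℕ) % 3 = 1 ∧ (r : ℕ) % 3 = 2 ∧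
      e = {p, q, r} := by
  have h := rainbow_iff (fun (i : Fin 3) (v : Fin n) => (v : ℕ) % 3 = (i : ℕ))
    (fun i j x hi hj => Fin.ext (hi.symm.trans hj)) e
  have h2 : ∀ i : Fin 3, e ∩ turanPart n i = e.filter fun v : Fin n => (v : ℕ) % 3 = (i : ℕ) := by
    intro i
    ext x
    simp [turanPart]
  simp only [T3, mem_filter, mem_univ, true_and, h2]
  exact h

lemma tau_le_card_T3 (n : ℕ) : tau n ≤ (T3 n).card := by
  have h : tau n = (univ : Finset (Fin ((n + 2) / 3) × Fin ((n + 1) / 3) × Fin (n / 3))).card := by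
    simp [tau]
    ring
  rw [h]
  refine card_le_card_of_injOn (fun x => ({⟨3 * x.1, by omega⟩, ⟨3 * x.2.1 + 1, by omega⟩,
    ⟨3 * x.2.2 + 2, by omega⟩} : Finset (Fin n))) ?_ ?_
  · intro x _
    exact mem_T3_iff.2 ⟨_, _, _, by simp, by simp [Nat.add_mod], by simp [Nat.add_mod], rfl⟩
  · rintro ⟨i, j, k⟩ - ⟨i', j', k'⟩ - h
    dsimp only at h
    rw [Finset.ext_iff] at h
    have h1 := (h ⟨3 * i, by omega⟩).1 (by simp)
    have h2 := (h ⟨3 * j + 1, by omega⟩).1 (by simp)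
    have h3 := (h ⟨3 * k + 2, by omega⟩).1 (by simp)
    simp only [mem_insert, mem_singleton, Fin.mk.injEq] at h1 h2 h3
    simp only [Prod.mk.injEq, Fin.ext_iff]
    omega

lemma mem_Gtmn_iff {t n : ℕ} {e : Finset (Fin n)} :
    e ∈ Gtmn t n ↔ (e.card = 3 ∧ ∃ v ∈ e, (v : ℕ) < t) ∨
      ∃ p q r : Fin n, (t ≤ p ∧ ((p : ℕ) - t) % 3 = 0) ∧ (t ≤ q ∧ ((q : ℕ) - t) % 3 = 1) ∧
        (t ≤ r ∧ ((r : ℕ) - t) % 3 = 2) ∧ e = {p, q, r} := by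
  have h := rainbow_iff (fun (i : Fin 3) (v : Fin n) => t ≤ (v : ℕ) ∧ ((v : ℕ) - t) % 3 = (i : ℕ))
    (fun i j x hi hj => Fin.ext (hi.2.symm.trans hj.2)) e
  simp only [Gtmn, mem_filter, mem_univ, true_and, and_or_left]
  exact or_congr Iff.rfl h

lemma card_Gtmn {t n : ℕ} (ht : t ≤ n) :
    (Gtmn t n).card = (T3 (n - t)).card + (n.choose 3 - (n - t).choose 3) := by
  have hinj : Function.Injective (fun v : Fin (n - t) => (⟨v + t, by omega⟩ : Fin n)) := by
    intro a b h
    simp only [Fin.mk.injEq] at h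
    exact Fin.ext (by omega)
  set f : Fin (n - t) ↪ Fin n := ⟨_, hinj⟩ with hf
  set L : Finset (Fin n) := univ.filter fun v => t ≤ (v : ℕ) with hL
  have hLm : L = univ.map f := by
    ext v
    simp only [hL, mem_filter, mem_univ, true_and, mem_map, hf, Function.Embedding.coeFn_mk,
      Fin.ext_iff]
    exact ⟨fun h => ⟨⟨v - t, by omega⟩, by simp; omega⟩, fun ⟨a, ha⟩ => by omega⟩
  have hLc : L.card = n - t := by rw [hLm, card_map, card_univ, Fintype.card_fin]
  have hG : Gtmn t n = (T3 (n - t)).image (fun e => e.image f) ∪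
      (powersetCard 3 univ \ powersetCard 3 L) := by
    ext e
    rw [mem_Gtmn_iff, mem_union, or_comm]
    refine or_congr ?_ ?_
    · simp only [mem_image, mem_T3_iff]
      constructor
      · rintro ⟨p, q, r, ⟨hp, hp'⟩, ⟨hq, hq'⟩, ⟨hr, hr'⟩, rfl⟩
        refine ⟨_, ⟨⟨p - t, by omega⟩, ⟨q - t, by omega⟩, ⟨r - t, by omega⟩, hp', hq', hr', rfl⟩, ?_⟩
        simp only [image_insert, image_singleton, hf, Function.Embedding.coeFn_mk,
          Nat.sub_add_cancel hp, Nat.sub_add_cancel hq, Nat.sub_add_cancel hr]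
      · rintro ⟨_, ⟨p, q, r, hp, hq, hr, rfl⟩, rfl⟩
        refine ⟨f p, f q, f r, ?_, ?_, ?_, by simp only [image_insert, image_singleton]⟩ <;>
          simp [hf, hp, hq, hr]
    · simp only [mem_sdiff, mem_powersetCard, subset_univ, true_and, not_and]
      constructor
      · rintro ⟨h3, v, hv, hvt⟩
        refine ⟨h3, fun h => ?_⟩
        have := h hv
        simp only [hL, mem_filter] at this
        omega
      · rintro ⟨h3, h⟩
        refine ⟨h3, ?_⟩
        by_contra! hcon
        exact h (fun v hv => by simpa [hL] using hcon v hv) h3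
  rw [hG, card_union_of_disjoint, card_image_of_injective _ (image_injective f.injective),
    card_sdiff_of_subset (powersetCard_mono (subset_univ _)), card_powersetCard, card_powersetCard,
    hLc, card_univ, Fintype.card_fin]
  rw [disjoint_left]
  intro e he he'
  simp only [mem_image, mem_T3_iff] at he
  obtain ⟨_, ⟨p, q, r, hp, hq, hr, rfl⟩, rfl⟩ := he
  simp only [mem_sdiff, mem_powersetCard, subset_univ, true_and, not_and] at he'
  refine he'.2 ?_ he'.1
  rw [hLm, map_eq_image]
  exact image_subset_image (subset_univ _)

lemma Gtmn_card_eq_three {t n : ℕ} : ∀ e ∈ Gtmn t n, e.card = 3 := fun _ he =>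
  (mem_filter.1 he).2.1

lemma not_hasCopy_Gtmn {m t n : ℕ} (hm : 2 ≤ m) :
    ¬ HasCopy (Gtmn t n) (copies (t + 1) (F5Sm m hm)) := by
  rintro ⟨f, hf⟩
  obtain ⟨j, hj⟩ : ∃ j, ∀ w, t ≤ (f (j, w) : ℕ) := by
    by_contra! hcon
    choose w hw using hcon
    have hinj : Function.Injective (fun j : Fin (t + 1) => (⟨f (j, w j), hw j⟩ : Fin t)) := by
      intro a b h
      simp only [Fin.mk.injEq] at h
      exact (Prod.mk.inj (f.injective (Fin.ext h))).1
    have := Fintype.card_le_of_injective _ hinj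
    simp at this
  set c : Fin (3 * m) ⊕ Unit → ℕ := fun w => ((f (j, w) : ℕ) - t) % 3 with hc
  have key : ∀ e ∈ F5Sm m hm, ∀ x ∈ e, ∀ y ∈ e, x ≠ y → c x ≠ c y := by
    intro e he x hx y hy hxy
    have h1 : (e.image fun w => (j, w)).image f ∈ Gtmn t n :=
      hf _ (mem_biUnion.2 ⟨j, mem_univ _, mem_image_of_mem _ he⟩)
    have hmem : ∀ x ∈ e, f (j, x) ∈ (e.image fun w => (j, w)).image f := fun x hx =>
      mem_image_of_mem _ (mem_image_of_mem _ hx)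
    rcases mem_Gtmn_iff.1 h1 with ⟨-, v, hv, hvt⟩ | ⟨p, q, r, ⟨-, hp⟩, ⟨-, hq⟩, ⟨-, hr⟩, h2⟩
    · simp only [mem_image] at hv
      obtain ⟨_, ⟨w, -, rfl⟩, rfl⟩ := hv
      exact absurd (hj w) (by omega)
    · have h3 := hmem x hx
      have h4 := hmem y hy
      have h5 : f (j, x) ≠ f (j, y) := fun h => hxy (Prod.mk.inj (f.injective h)).2
      rw [h2] at h3 h4
      simp only [mem_insert, mem_singleton] at h3 h4
      simp only [hc]
      rcases h3 with h3 | h3 | h3 <;> rcases h4 with h4 | h4 | h4 <;> rw [h3, h4] at h5 ⊢ <;>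
        first | exact absurd rfl h5 | omega
  have hT : ∀ p q r : Fin (3 * m), (p : ℕ) % 3 = 0 → (q : ℕ) % 3 = 1 → (r : ℕ) % 3 = 2 →
      ({Sum.inl p, Sum.inl q, Sum.inl r} : Finset (Fin (3 * m) ⊕ Unit)) ∈ F5Sm m hm := by
    intro p q r hp hq hr
    refine mem_union_left _ (mem_image.2 ⟨{p, q, r}, mem_T3_iff.2 ⟨p, q, r, hp, hq, hr, rfl⟩, ?_⟩)
    simp
  have e1 := key _ (hT ⟨0, by omega⟩ ⟨1, by omega⟩ ⟨2, by omega⟩ rfl rfl rfl)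
  have e2 := key _ (hT ⟨3, by omega⟩ ⟨1, by omega⟩ ⟨2, by omega⟩ (Nat.mod_self 3) rfl rfl)
  have e3 := key _ (mem_union_right _ (mem_singleton_self _))
  have f1 := e1 (Sum.inl ⟨0, by omega⟩) (by simp) (Sum.inl ⟨1, by omega⟩) (by simp) (by simp)
  have f2 := e1 (Sum.inl ⟨0, by omega⟩) (by simp) (Sum.inl ⟨2, by omega⟩) (by simp) (by simp)
  have f3 := e1 (Sum.inl ⟨1, by omega⟩) (by simp) (Sum.inl ⟨2, by omega⟩) (by simp) (by simp)
  have f4 := e2 (Sum.inl ⟨3, by omega⟩) (by simp) (Sum.inl ⟨1, by omega⟩) (by simp) (by simp)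
  have f5 := e2 (Sum.inl ⟨3, by omega⟩) (by simp) (Sum.inl ⟨2, by omega⟩) (by simp) (by simp)
  have f6 := e3 (Sum.inl ⟨0, by omega⟩) (by simp) (Sum.inl ⟨3, by omega⟩) (by simp) (by simp)
  have hlt : ∀ w, c w < 3 := fun w => Nat.mod_lt _ (by norm_num)
  have l0 := hlt (Sum.inl ⟨0, by omega⟩)
  have l1 := hlt (Sum.inl ⟨1, by omega⟩)
  have l2 := hlt (Sum.inl ⟨2, by omega⟩)
  have l3 := hlt (Sum.inl ⟨3, by omega⟩)
  omega

/-- An enumeration of `A` starting with two prescribed elements. -/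
lemma exists_enumeration {V : Type} {m : ℕ} (hm : 2 ≤ m) {A : Finset V} (hA : A.card = m)
    {a a' : V} (ha : a ∈ A) (ha' : a' ∈ A) (haa : a ≠ a') :
    ∃ f : Fin m → V, Function.Injective f ∧ (∀ i, f i ∈ A) ∧ f ⟨0, by omega⟩ = a ∧
      f ⟨1, by omega⟩ = a' := by
  classical
  set e : Fin m ≃ A := (A.equivFinOfCardEq hA).symm
  set e1 : Fin m ≃ A := (Equiv.swap ⟨0, by omega⟩ (e.symm ⟨a, ha⟩)).trans e with he1
  have h1 : e1 ⟨0, by omega⟩ = ⟨a, ha⟩ := by simp [he1]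
  set e2 : Fin m ≃ A := (Equiv.swap ⟨1, by omega⟩ (e1.symm ⟨a', ha'⟩)).trans e1 with he2
  have h2 : e2 ⟨1, by omega⟩ = ⟨a', ha'⟩ := by simp [he2]
  have h3 : e2 ⟨0, by omega⟩ = ⟨a, ha⟩ := by
    rw [he2, Equiv.trans_apply, Equiv.swap_apply_of_ne_of_ne, h1]
    · simp
    · intro h
      rw [Equiv.eq_symm_apply, h1] at h
      exact haa (congrArg Subtype.val h)
  exact ⟨fun i => e2 i, fun i j h => e2.injective (Subtype.ext h), fun i => (e2 i).2,
    congrArg Subtype.val h3, congrArg Subtype.val h2⟩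

section Embedding
variable {V : Type} [DecidableEq V] {H : Finset (Finset V)} {m : ℕ}

lemma IsCop.exists_embedding (hm : 2 ≤ m) {U : Finset V} (h : IsCop (tripleRel H) m U) :
    ∃ g : Fin (3 * m) ⊕ Unit → V, Function.Injective g ∧ (∀ w, g w ∈ U) ∧
      ∀ e ∈ F5Sm m hm, e.image g ∈ H := by
  obtain ⟨A, B, C, w, a, a', hA, hB, hC, hABC, ha, ha', haa, hwA, hwB, hwC, he, hU⟩ := h
  have hI := tripleRel_isTriple H
  obtain ⟨b, hb⟩ := card_pos.1 (by omega : 0 < B.card)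
  obtain ⟨c, hc⟩ := card_pos.1 (by omega : 0 < C.card)
  obtain ⟨fA, iA, mA, hA0, hA1⟩ := exists_enumeration hm hA ha ha' haa
  set fB : Fin m → V := fun i => ((B.equivFinOfCardEq hB).symm i : V)
  set fC : Fin m → V := fun i => ((C.equivFinOfCardEq hC).symm i : V)
  have iB : Function.Injective fB := fun i j h => Equiv.injective _ (Subtype.ext h)
  have iC : Function.Injective fC := fun i j h => Equiv.injective _ (Subtype.ext h)
  have mB : ∀ i, fB i ∈ B := fun i => Subtype.prop _
  have mC : ∀ i, fC i ∈ C := fun i => Subtype.prop _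
  have dAB : ∀ i j, fA i ≠ fB j := fun i j => hI.ne12 (hABC _ (mA i) _ (mB j) c hc)
  have dAC : ∀ i j, fA i ≠ fC j := fun i j => hI.ne13 (hABC _ (mA i) b hb _ (mC j))
  have dBC : ∀ i j, fB i ≠ fC j := fun i j => hI.ne23 (hABC a ha _ (mB i) _ (mC j))
  set g : Fin (3 * m) ⊕ Unit → V := Sum.elim (fun v =>
    if (v : ℕ) % 3 = 0 then fA ⟨v / 3, by omega⟩ else
    if (v : ℕ) % 3 = 1 then fB ⟨v / 3, by omega⟩ else fC ⟨v / 3, by omega⟩) (fun _ => w) with hg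
  have g0 : ∀ v : Fin (3 * m), (v : ℕ) % 3 = 0 → g (Sum.inl v) = fA ⟨v / 3, by omega⟩ :=
    fun v hv => by simp [hg, hv]
  have g1 : ∀ v : Fin (3 * m), (v : ℕ) % 3 = 1 → g (Sum.inl v) = fB ⟨v / 3, by omega⟩ :=
    fun v hv => by simp [hg, hv]
  have g2 : ∀ v : Fin (3 * m), (v : ℕ) % 3 = 2 → g (Sum.inl v) = fC ⟨v / 3, by omega⟩ :=
    fun v hv => by simp [hg, hv]
  have h3 : ∀ v : Fin (3 * m), (v : ℕ) % 3 = 0 ∨ (v : ℕ) % 3 = 1 ∨ (v : ℕ) % 3 = 2 := by omega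
  have hgw : ∀ v, g (Sum.inl v) ≠ w := by
    intro v
    rcases h3 v with h | h | h
    · rw [g0 v h]; exact fun e => hwA (e ▸ mA _)
    · rw [g1 v h]; exact fun e => hwB (e ▸ mB _)
    · rw [g2 v h]; exact fun e => hwC (e ▸ mC _)
  refine ⟨g, ?_, ?_, ?_⟩
  · have key : ∀ x y : Fin (3 * m), g (Sum.inl x) = g (Sum.inl y) → x = y := by
      intro x y h
      have fin : ∀ (hx : (x : ℕ) / 3 < m) (hy : (y : ℕ) / 3 < m), (x : ℕ) % 3 = (y : ℕ) % 3 →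
          (⟨x / 3, hx⟩ : Fin m) = ⟨y / 3, hy⟩ → x = y := by
        intro hx hy h1 h2
        rw [Fin.mk.injEq] at h2
        exact Fin.ext (by omega)
      rcases h3 x with hx | hx | hx <;> rcases h3 y with hy | hy | hy
      · rw [g0 x hx, g0 y hy] at h
        exact fin _ _ (hx.trans hy.symm) (iA h)
      · rw [g0 x hx, g1 y hy] at h
        exact absurd h (dAB _ _)
      · rw [g0 x hx, g2 y hy] at h
        exact absurd h (dAC _ _)
      · rw [g1 x hx, g0 y hy] at h
        exact absurd h.symm (dAB _ _)
      · rw [g1 x hx, g1 y hy] at h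
        exact fin _ _ (hx.trans hy.symm) (iB h)
      · rw [g1 x hx, g2 y hy] at h
        exact absurd h (dBC _ _)
      · rw [g2 x hx, g0 y hy] at h
        exact absurd h.symm (dAC _ _)
      · rw [g2 x hx, g1 y hy] at h
        exact absurd h.symm (dBC _ _)
      · rw [g2 x hx, g2 y hy] at h
        exact fin _ _ (hx.trans hy.symm) (iC h)
    rintro (x | x) (y | y) h
    · rw [key x y h]
    · exact absurd h (hgw x)
    · exact absurd h.symm (hgw y)
    · rfl
  · rintro (v | v)
    · rw [hU]
      rcases h3 v with h | h | h
      · rw [g0 v h]; exact Or.inl (mA _)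
      · rw [g1 v h]; exact Or.inr (Or.inl (mB _))
      · rw [g2 v h]; exact Or.inr (Or.inr (Or.inl (mC _)))
    · rw [hU]; exact Or.inr (Or.inr (Or.inr rfl))
  · intro e hemem
    rcases mem_union.1 hemem with h | h
    · obtain ⟨d, hd, rfl⟩ := mem_image.1 h
      obtain ⟨p, q, r, hp, hq, hr, rfl⟩ := mem_T3_iff.1 hd
      simp only [image_insert, image_singleton, g0 p hp, g1 q hq, g2 r hr]
      exact (hABC _ (mA _) _ (mB _) _ (mC _)).2.2.2
    · rw [mem_singleton.1 h]
      have k0 : g (Sum.inl ⟨0, by omega⟩) = a := by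
        rw [g0 _ (by norm_num)]; exact (congrArg fA (Fin.ext (by norm_num))).trans hA0
      have k3 : g (Sum.inl ⟨3, by omega⟩) = a' := by
        rw [g0 _ (by norm_num)]; exact (congrArg fA (Fin.ext (by norm_num))).trans hA1
      have kw : g (Sum.inr ()) = w := rfl
      simp only [image_insert, image_singleton, k0, k3, kw]
      exact (hI.rot (hI.rot he)).2.2.2

lemma HasCopies.exists_embeddings (hm : 2 ≤ m) : ∀ {k : ℕ} {X : Finset V},
    HasCopies (tripleRel H) m k X → ∃ g : Fin k → Fin (3 * m) ⊕ Unit → V,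
      (∀ j w, g j w ∈ X) ∧ (∀ j j' w w', g j w = g j' w' → j = j' ∧ w = w') ∧
      ∀ j, ∀ e ∈ F5Sm m hm, e.image (g j) ∈ H := by
  intro k
  induction k with
  | zero => exact fun _ => ⟨Fin.elim0, fun j => j.elim0, fun j => j.elim0, fun j => j.elim0⟩
  | succ k ih =>
    rintro X ⟨U, Y, hU, hY, hd, hc, h⟩
    obtain ⟨g, hgY, hginj, hgH⟩ := ih h
    obtain ⟨g', hinj', hgU, hgH'⟩ := hc.exists_embedding hm
    have hne : ∀ j w w', g j w ≠ g' w' := fun j w w' e =>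
      disjoint_left.1 hd (hgU w') (e ▸ hgY j w)
    refine ⟨Fin.cons g' g, fun j => ?_, fun j j' => ?_, fun j => ?_⟩
    · refine Fin.cases (fun w => hU (hgU w)) (fun i w => hY (hgY i w)) j
    · refine Fin.cases ?_ (fun i => ?_) j <;> refine Fin.cases ?_ (fun i' => ?_) j' <;>
        intro w w' e <;> simp only [Fin.cons_zero, Fin.cons_succ] at e
      · exact ⟨rfl, hinj' e⟩
      · exact absurd e.symm (hne _ _ _)
      · exact absurd e (hne _ _ _)
      · obtain ⟨rfl, rfl⟩ := hginj _ _ _ _ e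
        exact ⟨rfl, rfl⟩
    · refine Fin.cases hgH' (fun i => hgH i) j

lemma HasCopies.hasCopy (hm : 2 ≤ m) {k : ℕ} {X : Finset V}
    (h : HasCopies (tripleRel H) m k X) : HasCopy H (copies k (F5Sm m hm)) := by
  obtain ⟨g, -, hinj, hgH⟩ := h.exists_embeddings hm
  refine ⟨⟨fun x => g x.1 x.2, fun x y e => Prod.ext_iff.2 (hinj _ _ _ _ e)⟩, fun e he => ?_⟩
  obtain ⟨j, -, hj⟩ := mem_biUnion.1 he
  obtain ⟨d, hd, rfl⟩ := mem_image.1 hj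
  rw [image_image]
  exact hgH j d hd

end Embedding

theorem statement12 (m t : ℕ) (hm : 2 ≤ m) (ht : 1 ≤ t) :
    ∃ n0 : ℕ, ∀ n : ℕ, n ≥ n0 →
      exThree n (copies (t+1) (F5Sm m hm)) = (Gtmn t n).card ∧
      (Gtmn t n).card = (T3 (n - t)).card + (n.choose 3 - (n - t).choose 3) ∧
      (∀ e ∈ Gtmn t n, e.card = 3) ∧
      ¬ HasCopy (Gtmn t n) (copies (t+1) (F5Sm m hm)) := by
  obtain ⟨n0, hn0⟩ := tot_le_gval hm t
  refine ⟨max n0 t, fun n hn => ?_⟩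
  have hcard := card_Gtmn ((le_max_right n0 t).trans hn)
  refine ⟨?_, hcard, Gtmn_card_eq_three, not_hasCopy_Gtmn hm⟩
  refine IsGreatest.csSup_eq ⟨⟨Gtmn t n, Gtmn_card_eq_three, not_hasCopy_Gtmn hm, rfl⟩, ?_⟩
  rintro k ⟨H, h3, hfree, rfl⟩
  have h1 := card_le_tot H h3
  have h2 := hn0 (Fin n) (tripleRel H) univ (tripleRel_isTriple H)
    (by rw [card_univ, Fintype.card_fin]; exact (le_max_left n0 t).trans hn)
    (fun h => hfree (h.hasCopy hm))
  rw [card_univ, Fintype.card_fin] at h2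
  have h4 : (H.card : ℝ) ≤ gval t n := by linarith
  have h5 : H.card ≤ gval t n := by exact_mod_cast h4
  have h6 := tau_le_card_T3 (n - t)
  rw [hcard]
  refine h5.trans ?_
  rw [gval]
  omega
end

section
/- For all integers m ≥ 2, t ≥ 1 and n, the 3-graph G(t,m,n) contains no t+1 pairwise vertex-disjoint copies of F_5^S(m); that is, G(t,m,n) is (t+1)·F_5^S(m)-free. -/
open Finset

lemma mem_T3_of_mod {n : ℕ} {a b c : Fin n} (ha : (a : ℕ) % 3 = 0) (hb : (b : ℕ) % 3 = 1)
    (hc : (c : ℕ) % 3 = 2) : ({a, b, c} : Finset (Fin n)) ∈ T3 n := by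
  have hab : a ≠ b := by rintro rfl; omega
  have hac : a ≠ c := by rintro rfl; omega
  have hbc : b ≠ c := by rintro rfl; omega
  simp only [T3, mem_filter, mem_univ, true_and]
  refine ⟨card_eq_three.2 ⟨a, b, c, hab, hac, hbc, rfl⟩, fun i => card_eq_one.2 ?_⟩
  fin_cases i
  · refine ⟨a, ?_⟩
    ext x
    simp only [turanPart, mem_inter, mem_insert, mem_singleton, mem_filter, mem_univ, true_and]
    grind
  · refine ⟨b, ?_⟩
    ext x
    simp only [turanPart, mem_inter, mem_insert, mem_singleton, mem_filter, mem_univ, true_and]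
    grind
  · refine ⟨c, ?_⟩
    ext x
    simp only [turanPart, mem_inter, mem_insert, mem_singleton, mem_filter, mem_univ, true_and]
    grind

lemma Gtmn_mod_ne {t n : ℕ} {e : Finset (Fin n)} (he : e ∈ Gtmn t n)
    (hge : ∀ v ∈ e, t ≤ (v : ℕ)) {a b : Fin n} (ha : a ∈ e) (hb : b ∈ e) (hab : a ≠ b) :
    ((a : ℕ) - t) % 3 ≠ ((b : ℕ) - t) % 3 := by
  intro h
  simp only [Gtmn, mem_filter, mem_univ, true_and] at he
  obtain ⟨-, ⟨v, hv, hlt⟩ | hpart⟩ := he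
  · exact absurd (hge v hv) (by omega)
  · have h1 := hpart ⟨((a : ℕ) - t) % 3, Nat.mod_lt _ (by norm_num)⟩
    refine hab (card_le_one.1 h1.le a ?_ b ?_)
    · simp [ha, hge a ha]
    · simp [hb, hge b hb, h]

/-- Every copy of `F_5^S(m)` in `G(t,m,n)` uses a vertex of the `t`-set `T`. -/
lemma exists_lt_of_F5Sm_copy {m t n : ℕ} (hm : 2 ≤ m) {g : Fin (3 * m) ⊕ Unit → Fin n}
    (hg : Function.Injective g) (hcopy : ∀ e ∈ F5Sm m hm, e.image g ∈ Gtmn t n) :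
    ∃ w, (g w : ℕ) < t := by
  by_contra! hge
  have hne : ∀ e ∈ F5Sm m hm, ∀ x ∈ e, ∀ y ∈ e, x ≠ y →
      ((g x : ℕ) - t) % 3 ≠ ((g y : ℕ) - t) % 3 := fun e he x hx y hy hxy =>
    Gtmn_mod_ne (hcopy e he) (forall_mem_image.2 fun v _ => hge v) (mem_image_of_mem g hx) (mem_image_of_mem g hy)
      (hg.ne hxy)
  have hT : ∀ a b c : Fin (3 * m), (a : ℕ) % 3 = 0 → (b : ℕ) % 3 = 1 → (c : ℕ) % 3 = 2 →
      ({Sum.inl a, Sum.inl b, Sum.inl c} : Finset (Fin (3 * m) ⊕ Unit)) ∈ F5Sm m hm := by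
    intro a b c ha hb hc
    refine mem_union_left _ (mem_image.2 ⟨_, mem_T3_of_mod ha hb hc, ?_⟩)
    simp [image_insert]
  let v0 : Fin (3 * m) := ⟨0, by omega⟩
  let v1 : Fin (3 * m) := ⟨1, by omega⟩
  let v2 : Fin (3 * m) := ⟨2, by omega⟩
  let v3 : Fin (3 * m) := ⟨3, by omega⟩
  have h012 := hne _ (hT v0 v1 v2 rfl rfl rfl)
  have h312 := hne _ (hT v3 v1 v2 (Nat.mod_self 3) rfl rfl)
  have h01 := h012 (Sum.inl v0) (by simp) (Sum.inl v1) (by simp) (by simp [v0, v1])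
  have h02 := h012 (Sum.inl v0) (by simp) (Sum.inl v2) (by simp) (by simp [v0, v2])
  have h12 := h012 (Sum.inl v1) (by simp) (Sum.inl v2) (by simp) (by simp [v1, v2])
  have h31 := h312 (Sum.inl v3) (by simp) (Sum.inl v1) (by simp) (by simp [v3, v1])
  have h32 := h312 (Sum.inl v3) (by simp) (Sum.inl v2) (by simp) (by simp [v3, v2])
  have h03 := hne _ (mem_union_right _ (mem_singleton_self _)) (Sum.inl v0) (by simp [v0])
    (Sum.inl v3) (by simp [v3]) (by simp [v0, v3])
  omega

theorem statement13 (m t : ℕ) (hm : 2 ≤ m) (ht : 1 ≤ t) (n : ℕ) :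
    ¬ HasCopy (Gtmn t n) (copies (t+1) (F5Sm m hm)) := by
  rintro ⟨f, hf⟩
  have hlt : ∀ j : Fin (t + 1), ∃ w, (f (j, w) : ℕ) < t := fun j => by
    refine exists_lt_of_F5Sm_copy hm (g := fun w => f (j, w))
      (f.injective.comp (Prod.mk_right_injective j)) fun e he => ?_
    have := hf (e.image fun w => (j, w))
      (mem_biUnion.2 ⟨j, mem_univ j, mem_image_of_mem _ he⟩)
    rwa [image_image] at this
  choose w hw using hlt
  obtain ⟨i, j, hij, h⟩ := Fintype.exists_ne_map_eq_of_card_lt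
    (fun j => (⟨f (j, w j), hw j⟩ : Fin t)) (by simp)
  exact hij (Prod.ext_iff.1 (f.injective (Fin.ext (Fin.mk.inj h)))).1
end
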